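/- The inverse map Ψ_a: given a KN column T of type C_n of height a, letting T₊ (resp. T₋) be the subcolumn with entries in [n] (resp. in [n̄]), and letting ~T₊ be the column over [n̄] whose entries are the barred complements of the unbarred entries not in T₊, the tableau Ψ_a(T) = 𝓕^{n−a}(T₋, ~T₊) lies in T^{c_n}(n−a), and Ψ_a is an isomorphism of c_n-crystals from KN^{c_n}_{(1^a)} to T^{c_n}(n−a). -/

import Mathlib

/-!
Statement 10: for a KN column `T` of type `C_n` of height `a`, the tableau
`Ψ_a(T) = 𝓕^{n−a}(T₋, ~T₊)` lies in `T^{c_n}(n−a)`, and `Ψ_a` is an isomorphism of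
`c_n`-crystals from `KN^{c_n}_{(1^a)}` to `T^{c_n}(n−a)` (in particular a bijection
commuting with all Kashiwara operators and preserving weights).

Encodings as in the spinor model: `𝕁_n^×` is `{0,…,2n−1}` (letter `k` is `k−1`, `k̄` is
`2n−k`); `(T₋, ~T₊)` is arranged as the unique two-column skew tableau with `r = 0`
(canonical offset) and `𝓕` is jeu de taquin into the position above the top of the left
column.
-/

namespace KN

/-- The `i`-th entry from the bottom (1-indexed) of a column written top-to-bottom. -/
def getB (l : List ℕ) (i : ℕ) : Option ℕ :=
  if 1 ≤ i ∧ i ≤ l.length then l[l.length - i]? else none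

/-- Semistandardness of a two-column skew tableau of shape `λ(a,b,c)` with left column `L`
(of length `c+a`), right column `R` (of length `b+c`), both written top-to-bottom:
columns strictly increase and, in each of the `c` overlapping rows, the left entry is
no greater than the right entry. -/
def PairSSD (b : ℕ) (L R : List ℕ) : Prop :=
  L.Chain' (· < ·) ∧ R.Chain' (· < ·) ∧
    ∀ i x y, L[i]? = some x → R[b + i]? = some y → x ≤ y

/-- `r_T = 0`: the right column of `T` cannot be slid down one position while keeping
semistandardness (automatic when `a = 0` or `b = 0`). -/
def SlideZero (a b : ℕ) (L R : List ℕ) : Prop :=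
  a = 0 ∨ b = 0 ∨ ∃ i x y, L[i]? = some x ∧ R[b + i - 1]? = some y ∧ y < x

/-- State of a two-column skew tableau: `(b, L, R)` where `b` is the shape parameter
(length of the empty upper part of the left column). -/
abbrev TC := ℕ × List ℕ × List ℕ

def FCond (b : ℕ) (L R : List ℕ) (i : ℕ) : Bool :=
  match L[i]?, R[b - 1 + i]? with
  | _, none => false
  | none, some _ => true
  | some x, some y => decide (y < x)

/-- The jeu de taquin operator `𝓕`: slide into the position above the top of the left
column; the result has shape `λ(a+1, b−1, c)`. -/
def Fop : TC → Option TC := fun t =>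
  let b := t.1; let L := t.2.1; let R := t.2.2
  if b = 0 then none else
    match (List.range (L.length + 1)).find? (fun i => FCond b L R i) with
    | none => none
    | some i =>
        match R[b - 1 + i]? with
        | some y => some (b - 1, L.take i ++ y :: L.drop i, R.eraseIdx (b - 1 + i))
        | none => none

def ECond (b : ℕ) (L R : List ℕ) (i : ℕ) : Bool :=
  match L[i]? with
  | none => false
  | some x =>
      if b + i = 0 then true
      else match R[b + i - 1]? with
        | none => true
        | some y => decide (y < x)

/-- The jeu de taquin operator `𝓔`: slide into the position below the bottom of the right
column; the result has shape `λ(a−1, b+1, c)`. -/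
def Eop : TC → Option TC := fun t =>
  let b := t.1; let L := t.2.1; let R := t.2.2
  if L.length + b ≤ R.length then none else
    match ((List.range (R.length - b + 1)).reverse).find? (fun i => ECond b L R i) with
    | none => none
    | some i =>
        match L[i]? with
        | some x => some (b + 1, L.eraseIdx i, R.insertIdx (b + i) x)
        | none => none

/-- Iteration of a partial operator. -/
def iterO {α : Type} (g : α → Option α) : ℕ → α → Option α
  | 0, t => some t
  | k + 1, t => (g t).bind (iterO g k)

/-- Bounded boolean test of two-column semistandardness (overlap part only). -/
def ssdB (b : ℕ) (U V : List ℕ) : Bool :=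
  (List.range U.length).all fun i =>
    match U[i]?, V[b + i]? with
    | some x, some y => decide (x ≤ y)
    | _, _ => true

/-- The canonical offset of a pair of columns `(U, V)` (`U` left, `V` right): the least `b`
such that the two-column arrangement with offset `b` is semistandard; this realizes `(U,V)`
as the two-column tableau `T` with `(T^L, T^R) = (U, V)` and `r_T = 0`. -/
def pairOffset (U V : List ℕ) : ℕ :=
  match (List.range (V.length + 1)).find? (fun b =>
      decide (V.length ≤ U.length + b) && ssdB b U V) with
  | some b => b
  | none => V.length

/-- `𝓕` on a pair of single columns. -/
def pairF (U V : List ℕ) : Option (List ℕ × List ℕ) :=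
  (Fop (pairOffset U V, U, V)).map fun t => (t.2.1, t.2.2)

/-- `𝓔` on a pair of single columns. -/
def pairE (U V : List ℕ) : Option (List ℕ × List ℕ) :=
  (Eop (pairOffset U V, U, V)).map fun t => (t.2.1, t.2.2)

/-- `𝓕_i` on a tuple of columns (components listed right-to-left, 0-based index `k = i−1`):
apply `𝓕` to the pair formed by components `k+1` (left) and `k` (right). -/
def FiOp (k : ℕ) (us : List (List ℕ)) : Option (List (List ℕ)) :=
  match us[k]?, us[k+1]? with
  | some V, some U => (pairF U V).map fun p => (us.set (k+1) p.1).set k p.2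
  | _, _ => none

/-- `𝓔_i` on a tuple of columns. -/
def EiOp (k : ℕ) (us : List (List ℕ)) : Option (List (List ℕ)) :=
  match us[k]?, us[k+1]? with
  | some V, some U => (pairE U V).map fun p => (us.set (k+1) p.1).set k p.2
  | _, _ => none

end KN
namespace KN

/-- A seminormal pre-crystal structure on a type `α`, with index set `ℕ`
(only finitely many indices are relevant in each use). -/
structure PreCrystal (α : Type) where
  eps : α → ℕ → ℤ
  phi : α → ℕ → ℤ
  e : ℕ → α → Option α
  f : ℕ → α → Option α

variable {α : Type}

/-- `ε_i` of a tensor product `b₁ ⊗ b₂ ⊗ ⋯` (list order = tensor order), computed from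
the tensor product rule using `⟨wt b, h_i⟩ = φ_i(b) − ε_i(b)`. -/
def listEps (C : PreCrystal α) (i : ℕ) : List α → ℤ
  | [] => 0
  | x :: xs => max (C.eps x i) (listEps C i xs - (C.phi x i - C.eps x i))

def listPhi (C : PreCrystal α) (i : ℕ) : List α → ℤ
  | [] => 0
  | x :: xs => max (C.phi x i + (listPhi C i xs - listEps C i xs)) (listPhi C i xs)

/-- `ẽ_i` on a tensor product: `ẽ_i(b₁ ⊗ b₂) = ẽ_i b₁ ⊗ b₂` if `φ_i(b₁) ≥ ε_i(b₂)`,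
else `b₁ ⊗ ẽ_i b₂`. -/
def listE (C : PreCrystal α) (i : ℕ) : List α → Option (List α)
  | [] => none
  | x :: xs =>
      if listEps C i xs ≤ C.phi x i then (C.e i x).map (· :: xs)
      else (listE C i xs).map (x :: ·)

/-- `f̃_i` on a tensor product: `f̃_i(b₁ ⊗ b₂) = f̃_i b₁ ⊗ b₂` if `φ_i(b₁) > ε_i(b₂)`,
else `b₁ ⊗ f̃_i b₂`. -/
def listF (C : PreCrystal α) (i : ℕ) : List α → Option (List α)
  | [] => none
  | x :: xs =>
      if listEps C i xs < C.phi x i then (C.f i x).map (· :: xs)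
      else (listF C i xs).map (x :: ·)

/-! The one-box crystal of type `C_n`:
`1 → 2 → ⋯ → n → n̄ → ⋯ → 2̄ → 1̄`, with the letter `k` encoded as `k−1` and `k̄` as
`2n−k`; the arrow label `i` ranges over `1 ≤ i ≤ n` (1-based). -/

def boxCe (n i v : ℕ) : Option ℕ :=
  if 1 ≤ i ∧ i < n then
    (if v = i then some (i - 1) else if v + i = 2 * n then some (v - 1) else none)
  else if i = n then (if v = n then some (n - 1) else none)
  else none

def boxCf (n i v : ℕ) : Option ℕ :=
  if 1 ≤ i ∧ i < n then
    (if v + 1 = i then some i else if v + 1 + i = 2 * n then some (v + 1) else none)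
  else if i = n then (if v + 1 = n then some n else none)
  else none

def boxC (n : ℕ) : PreCrystal ℕ where
  eps v i := if (boxCe n i v).isSome then 1 else 0
  phi v i := if (boxCf n i v).isSome then 1 else 0
  e i v := boxCe n i v
  f i v := boxCf n i v

/-- The weight in `ℤ^n` of a letter of `𝕁_n^×` (1-based coordinate `k`):
`wt(k) = ε_k`, `wt(k̄) = −ε_k`. -/
def wtBox (n v k : ℕ) : ℤ :=
  if v + 1 = k then 1 else if v + k = 2 * n then -1 else 0

def wtList (n : ℕ) (l : List ℕ) (k : ℕ) : ℤ := (l.map fun v => wtBox n v k).sum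

/-- Reconstitute a list of columns from its (modified) reading word. -/
def rebuildJoin (cols : List (List ℕ)) (w : List ℕ) : List (List ℕ) :=
  (cols.foldl (fun (st : List (List ℕ) × List ℕ) c =>
      (st.1 ++ [st.2.take c.length], st.2.drop c.length)) ([], w)).1

/-- Crystal operator `ẽ_i` on a tableau given as a list of columns (rightmost first, each
top-to-bottom), via the column reading word. -/
def tabE (n i : ℕ) (cols : List (List ℕ)) : Option (List (List ℕ)) :=
  (listE (boxC n) i cols.flatten).map (rebuildJoin cols)

def tabF (n i : ℕ) (cols : List (List ℕ)) : Option (List (List ℕ)) :=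
  (listF (boxC n) i cols.flatten).map (rebuildJoin cols)

/-- Does a two-column tableau `(L,R)` (pair of columns over `[n̄]`) carry a domino of two
`n̄`'s on its top? -/
def dominoTop (n : ℕ) (p : List ℕ × List ℕ) : Bool :=
  (p.1.head? == some n) && (p.2.head? == some n) && decide (p.2.length ≤ p.1.length)

/-- Can a domino of two `n̄`'s be added on top of a two-column tableau `(L,R)`? -/
def canDomino (n : ℕ) (p : List ℕ × List ℕ) : Bool :=
  (match p.1.head? with | some x => decide (n < x) | none => true) &&
  (match p.2.head? with | some x => decide (n < x) | none => true) &&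
  decide (p.2.length ≤ p.1.length)

/-- The pre-crystal structure on two-column tableaux `(L,R)` over `[n̄]`: for `i < n`
via the column reading word `R ++ L`; for `i = n` by removing/adding an `n̄n̄`-domino
on the top. -/
def pairPC (n : ℕ) : PreCrystal (List ℕ × List ℕ) where
  eps p i := if i = n then (if dominoTop n p then 1 else 0)
             else listEps (boxC n) i (p.2 ++ p.1)
  phi p i := if i = n then (if canDomino n p then 1 else 0)
             else listPhi (boxC n) i (p.2 ++ p.1)
  e i p := if i = n then (if dominoTop n p then some (p.1.tail, p.2.tail) else none)
           else (listE (boxC n) i (p.2 ++ p.1)).map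
              (fun w => (w.drop p.2.length, w.take p.2.length))
  f i p := if i = n then (if canDomino n p then some (n :: p.1, n :: p.2) else none)
           else (listF (boxC n) i (p.2 ++ p.1)).map
              (fun w => (w.drop p.2.length, w.take p.2.length))

end KN
namespace KN

/-- The tableau `~(^R T)`: the increasing column with entries the letters `k ∈ [n]`
(code `k−1`) such that `k̄` (code `2n−k`) does not occur in `^R T`. -/
def compBar (n : ℕ) (RT : List ℕ) : List ℕ :=
  (List.range n).filter fun j => ! RT.contains (2 * n - 1 - j)

/-- The map `T ↦ T̃` on `T^{c_n}(a)` (shape `λ(a,0,c)`). -/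
def tildeMap (n a : ℕ) (p : List ℕ × List ℕ) : List ℕ :=
  match iterO Eop a (0, p.1, p.2) with
  | some t => compBar n t.2.2 ++ t.2.1
  | none => []

/-- The Kashiwara–Nakashima one-column condition of type `C_n` for a column of height
`h`. -/
def KN1 (n h : ℕ) (l : List ℕ) : Prop :=
  ∀ c i₁ i₂, 1 ≤ c → c ≤ n →
    getB l i₁ = some (2 * n - c) → getB l i₂ = some (c - 1) → i₁ < i₂ →
      i₁ + h + 1 ≤ c + i₂

/-- The set `T^{c_n}(a)`, encoded as pairs of columns `(L, R)` over
`[n̄] = {n,…,2n−1}` forming a semistandard tableau of shape `λ(a,0,c)`. -/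
def TCnSet (n a : ℕ) : Set (List ℕ × List ℕ) :=
  {p | p.1.length = p.2.length + a ∧ PairSSD 0 p.1 p.2 ∧
      (∀ x ∈ p.1, n ≤ x ∧ x < 2 * n) ∧ ∀ x ∈ p.2, n ≤ x ∧ x < 2 * n}

/-- The set `KN^{c_n}_{(1^h)}` of KN columns of type `C_n` of height `h`, over
`𝕁_n^× = {1 < ⋯ < n < n̄ < ⋯ < 1̄}` encoded as `{0,…,2n−1}`. -/
def KNcolC (n h : ℕ) : Set (List ℕ) :=
  {l | l.length = h ∧ l.Chain' (· < ·) ∧ (∀ x ∈ l, x < 2 * n) ∧ KN1 n h l}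

/-- The inverse map `Ψ_a`: split a KN column `T` into its barred part `T₋` and the barred
complement `~T₊` of its unbarred part, and apply `𝓕^{n−a}`. -/
def PsiCol (n : ℕ) (T : List ℕ) : List ℕ × List ℕ :=
  let U := T.filter fun x => decide (n ≤ x)
  let V := (List.range n).filterMap fun j =>
    let k := n - j
    if T.contains (k - 1) then none else some (2 * n - k)
  match iterO Fop (n - T.length) (pairOffset U V, U, V) with
  | some t => (t.2.1, t.2.2)
  | none => ([], [])

end KN

namespace KN

/-- The number of indices below the bound at which the indicator is true. -/
def cnt (u : ℕ → Bool) : ℕ → ℕ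
  | 0 => 0
  | x + 1 => cnt u x + (u x).toNat

/-- The gap between the running maximum and the current value of the walk. -/
def gap (u v : ℕ → Bool) : ℕ → ℕ
  | 0 => 0
  | x + 1 => if u x = v x then gap u v x else if u x then gap u v x + 1 else gap u v x - 1

/-- Record positions of the walk. -/
def rec1 (u v : ℕ → Bool) (x : ℕ) : Bool := v x && !u x && decide (gap u v x = 0)

def outU (u v : ℕ → Bool) (x : ℕ) : Bool := u x || rec1 u v x
def outV (u v : ℕ → Bool) (x : ℕ) : Bool := v x && !rec1 u v x

/-- The column with indicator function `u`. -/
def col (n : ℕ) (u : ℕ → Bool) : List ℕ := (List.range (2 * n)).filter u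

theorem cnt_mono (u : ℕ → Bool) {x y : ℕ} (h : x ≤ y) : cnt u x ≤ cnt u y := by
  induction h with
  | refl => exact le_rfl
  | step h ih => simp only [cnt]; omega

theorem length_filter_range (u : ℕ → Bool) (N : ℕ) :
    ((List.range N).filter u).length = cnt u N := by
  induction N with
  | zero => simp [cnt]
  | succ N ih => simp only [List.range_succ, List.filter_append, List.length_append, ih, cnt]
                 cases h : u N <;> simp [h]

theorem length_col (n : ℕ) (u : ℕ → Bool) : (col n u).length = cnt u (2 * n) :=
  length_filter_range u _

theorem get_filter_range (u : ℕ → Bool) (N i x : ℕ) :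
    ((List.range N).filter u)[i]? = some x ↔ x < N ∧ u x = true ∧ cnt u x = i := by
  induction N with
  | zero => simp
  | succ N ih =>
    rw [List.range_succ, List.filter_append, List.getElem?_append]
    have hl := length_filter_range u N
    rw [hl]
    split_ifs with h
    · rw [ih]
      constructor
      · rintro ⟨h1, h2, h3⟩; exact ⟨by omega, h2, h3⟩
      · rintro ⟨h1, h2, h3⟩
        refine ⟨?_, h2, h3⟩
        rcases Nat.lt_succ_iff_lt_or_eq.1 h1 with h4 | h4
        · exact h4
        · subst h4; omega
    · constructor
      · intro h1
        cases hN : u N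
        · simp [hN] at h1
        · simp only [hN, List.filter_cons_of_pos, List.filter_nil] at h1
          rcases Nat.eq_zero_or_pos (i - cnt u N) with h0 | h0
          · rw [h0] at h1; simp at h1; subst h1; exact ⟨by omega, hN, by omega⟩
          · obtain ⟨m, hm⟩ : ∃ m, i - cnt u N = m + 1 := ⟨i - cnt u N - 1, by omega⟩
            rw [hm] at h1; simp at h1
      · rintro ⟨h1, h2, h3⟩
        rcases Nat.lt_succ_iff_lt_or_eq.1 h1 with h4 | h4
        · have := cnt_mono u (show x + 1 ≤ N from h4)
          simp only [cnt, h2] at this; simp at this; omega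
        · subst h4; simp [h2, h3]

theorem get_col (n : ℕ) (u : ℕ → Bool) (i x : ℕ) :
    (col n u)[i]? = some x ↔ x < 2 * n ∧ u x = true ∧ cnt u x = i := get_filter_range u _ i x

theorem exists_cnt (u : ℕ → Bool) (N i : ℕ) (h : i < cnt u N) :
    ∃ x, x < N ∧ u x = true ∧ cnt u x = i := by
  rw [← length_filter_range] at h
  exact ⟨_, (get_filter_range u N i _).1 (List.getElem?_eq_getElem h)⟩

theorem inv1 (u v : ℕ → Bool) (x : ℕ) :
    cnt v x + gap u v x = cnt u x + cnt (rec1 u v) x := by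
  induction x with
  | zero => rfl
  | succ x ih =>
    simp only [cnt, gap, rec1] at *
    cases hu : u x <;> cases hv : v x <;> simp <;> try omega
    by_cases h : gap u v x = 0 <;> simp [h] <;> omega

theorem inv2 (u v : ℕ → Bool) (x : ℕ) :
    cnt (outV u v) x + cnt (rec1 u v) x = cnt v x := by
  induction x with
  | zero => rfl
  | succ x ih =>
    simp only [cnt, outV] at *
    have : rec1 u v x = true → v x = true := by simp only [rec1]; simp; tauto
    cases hu : rec1 u v x <;> cases hv : v x <;> simp_all <;> omega

theorem inv3 (u v : ℕ → Bool) (x : ℕ) :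
    cnt (outU u v) x = cnt (rec1 u v) x + cnt u x := by
  induction x with
  | zero => rfl
  | succ x ih =>
    simp only [cnt, outU] at *
    have : rec1 u v x = true → u x = false := by simp only [rec1]; simp; tauto
    cases hu : rec1 u v x <;> cases hv : u x <;> simp_all <;> omega

theorem gap_ub (u v : ℕ → Bool) (x : ℕ) : ∀ y ≤ x, cnt v y + cnt u x ≤ cnt v x + cnt u y + gap u v x := by
  intro y hy
  have h1 := inv1 u v x
  have h2 := inv1 u v y
  have := cnt_mono (rec1 u v) hy
  omega

theorem gap_att (u v : ℕ → Bool) (x : ℕ) : ∃ y ≤ x, cnt v y + cnt u x = cnt v x + cnt u y + gap u v x := by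
  induction x with
  | zero => exact ⟨0, le_rfl, rfl⟩
  | succ x ih =>
    obtain ⟨y, hy, h⟩ := ih
    by_cases hr : rec1 u v x = true
    · refine ⟨x + 1, le_rfl, ?_⟩
      simp only [rec1, Bool.and_eq_true, Bool.not_eq_true', decide_eq_true_eq] at hr
      simp [gap, hr]
    · refine ⟨y, by omega, ?_⟩
      simp only [rec1, Bool.and_eq_true, Bool.not_eq_true', decide_eq_true_eq, not_and] at hr
      simp only [cnt, gap]
      cases hu : u x <;> cases hv : v x <;> simp_all <;> omega

theorem gap_congr {u v u2 v2 : ℕ → Bool} (N : ℕ) (h : ∀ x < N, u x = u2 x ∧ v x = v2 x) :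
    ∀ x ≤ N, gap u v x = gap u2 v2 x := by
  intro x
  induction x with
  | zero => intro _; rfl
  | succ x ih => intro hx; simp only [gap, ih (by omega), (h x (by omega)).1, (h x (by omega)).2]

/-- injectivity of the transformation -/
theorem out_inj (u v u2 v2 : ℕ → Bool) (N : ℕ) (hg : gap u v N = gap u2 v2 N)
    (h : ∀ x < N, outU u v x = outU u2 v2 x ∧ outV u v x = outV u2 v2 x) :
    ∀ x < N, u x = u2 x ∧ v x = v2 x := by
  induction N with
  | zero => intro x hx; omega
  | succ N ih =>
    have hN := h N (by omega)
    have key : gap u v N = gap u2 v2 N ∧ u N = u2 N ∧ v N = v2 N := by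
      simp only [outU, outV, rec1, gap] at hN hg
      clear h ih
      revert hN hg
      generalize gap u v N = g
      generalize gap u2 v2 N = g2
      generalize u N = a
      generalize v N = b
      generalize u2 N = a2
      generalize v2 N = b2
      intro hN hg
      rcases Nat.eq_zero_or_pos g with h0 | h0 <;>
      rcases Nat.eq_zero_or_pos g2 with h1 | h1 <;>
      cases a <;> cases b <;> cases a2 <;> cases b2 <;>
        simp [h0, h1, Nat.ne_of_gt] at hN hg ⊢ <;> omega
    intro x hx
    rcases Nat.lt_succ_iff_lt_or_eq.1 hx with h4 | h4
    · exact ih key.1 (fun x hx => h x (by omega)) x h4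
    · subst h4; exact key.2

/-- A run with arbitrary starting gap. -/
def gap0 (d : ℕ) (u v : ℕ → Bool) : ℕ → ℕ
  | 0 => d
  | x + 1 => if u x = v x then gap0 d u v x else if u x then gap0 d u v x + 1
      else gap0 d u v x - 1

def rec0 (d : ℕ) (u v : ℕ → Bool) (x : ℕ) : Bool := v x && !u x && decide (gap0 d u v x = 0)

theorem gap0_zero (u v : ℕ → Bool) (x : ℕ) : gap0 0 u v x = gap u v x := by
  induction x with
  | zero => rfl
  | succ x ih => simp only [gap, gap0, ih]

theorem gap0_congr {d : ℕ} {u v u2 v2 : ℕ → Bool} (N : ℕ) (h : ∀ x < N, u x = u2 x ∧ v x = v2 x) :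
    ∀ x ≤ N, gap0 d u v x = gap0 d u2 v2 x := by
  intro x
  induction x with
  | zero => intro _; rfl
  | succ x ih => intro hx; simp only [gap0, ih (by omega), (h x (by omega)).1, (h x (by omega)).2]

theorem back_exists (p q : ℕ → Bool) (N : ℕ) : ∀ e, ∃ d u v, gap0 d u v N = e ∧
    ∀ x < N, (u x || rec0 d u v x) = p x ∧ (v x && !rec0 d u v x) = q x := by
  induction N with
  | zero => intro e; exact ⟨e, p, q, rfl, by omega⟩
  | succ N ih =>
    intro e
    have key : ∃ e' a b, (if a = b then e' else if a = true then e' + 1 else e' - 1) = e ∧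
        (a || (b && !a && decide (e' = 0))) = p N ∧ (b && !(b && !a && decide (e' = 0))) = q N := by
      cases hp : p N <;> cases hq : q N
      · exact ⟨e, false, false, by simp⟩
      · exact ⟨e + 1, false, true, by simp⟩
      · rcases Nat.eq_zero_or_pos e with h | h
        · exact ⟨0, false, true, by simp [h]⟩
        · exact ⟨e - 1, true, false, by simp; omega⟩
      · exact ⟨e, true, true, by simp⟩
    obtain ⟨e', a, b, h1, h2, h3⟩ := key
    obtain ⟨d, u, v, h4, h5⟩ := ih e'
    have hc : ∀ x ≤ N, gap0 d (Function.update u N a) (Function.update v N b) x = gap0 d u v x := by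
      apply gap0_congr
      intro x hx
      simp [Function.update_of_ne (show x ≠ N by omega)]
    refine ⟨d, Function.update u N a, Function.update v N b, ?_, ?_⟩
    · simp only [gap0, hc N le_rfl, Function.update_self, h4, h1]
    · intro x hx
      rcases Nat.lt_succ_iff_lt_or_eq.1 hx with h6 | h6
      · have := h5 x h6
        simp only [rec0, hc x h6.le, Function.update_of_ne (show x ≠ N by omega)] at *
        exact this
      · subst h6
        simp only [rec0, hc x le_rfl, Function.update_self, h4]
        exact ⟨h2, h3⟩

theorem inv0 (p q : ℕ → Bool) (d : ℕ) (u v : ℕ → Bool) (N : ℕ)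
    (h : ∀ x < N, (u x || rec0 d u v x) = p x ∧ (v x && !rec0 d u v x) = q x) :
    ∀ x ≤ N, cnt q x + gap0 d u v x + cnt (rec0 d u v) x = cnt p x + d := by
  intro x
  induction x with
  | zero => intro _; simp [cnt, gap0]
  | succ x ih =>
    intro hx
    have := ih (by omega)
    have h1 := h x (by omega)
    simp only [cnt, gap0, ← h1.1, ← h1.2]
    have hr : rec0 d u v x = (v x && !u x && decide (gap0 d u v x = 0)) := rfl
    by_cases h0 : gap0 d u v x = 0 <;>
    cases hu : u x <;> cases hv : v x <;> simp_all <;> omega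

theorem exists_zero (d : ℕ) (u v : ℕ → Bool) (N : ℕ) (h : gap0 d u v N = 0) :
    ∃ x ≤ N, gap0 d u v x = 0 ∧ cnt (rec0 d u v) x = 0 := by
  have hex : ∃ x, gap0 d u v x = 0 := ⟨N, h⟩
  refine ⟨Nat.find hex, Nat.find_min' hex h, Nat.find_spec hex, ?_⟩
  have : ∀ x ≤ Nat.find hex, cnt (rec0 d u v) x = 0 := by
    intro x
    induction x with
    | zero => intro _; rfl
    | succ x ih =>
      intro hx
      have := Nat.find_min hex (show x < Nat.find hex by omega)
      simp [cnt, ih (by omega), rec0, this]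
  exact this _ le_rfl

/-- surjectivity of the transformation -/
theorem out_surj (p q : ℕ → Bool) (N : ℕ) (h : ∀ x ≤ N, cnt q x ≤ cnt p x) :
    ∃ u v, gap u v N = 0 ∧ ∀ x < N, outU u v x = p x ∧ outV u v x = q x := by
  obtain ⟨d, u, v, h1, h2⟩ := back_exists p q N 0
  obtain ⟨x, hx, h3, h4⟩ := exists_zero d u v N h1
  have h5 := inv0 p q d u v N h2 x hx
  have h6 := h x hx
  have hd : d = 0 := by
    have := h x hx
    omega
  subst hd
  refine ⟨u, v, by rw [← gap0_zero]; exact h1, ?_⟩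
  intro x hx
  have := h2 x hx
  simpa only [outU, outV, rec1, rec0, gap0_zero] using this

end KN
namespace KN

theorem range_split (N y : ℕ) (h : y < N) :
    List.range N = List.range y ++ y :: List.range' (y + 1) (N - y - 1) := by
  obtain ⟨m, rfl⟩ : ∃ m, N = y + (m + 1) := ⟨N - y - 1, by omega⟩
  rw [List.range_eq_range', List.range_eq_range', ← List.range'_append_1, List.range'_succ]
  simp only [Nat.zero_add]
  congr 3
  omega

theorem filter_update_lo (u : ℕ → Bool) (y : ℕ) (a : Bool) :
    (List.range y).filter (Function.update u y a) = (List.range y).filter u := by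
  apply List.filter_congr
  intro x hx
  rw [Function.update_of_ne]
  have := List.mem_range.1 hx
  omega

theorem filter_update_hi (u : ℕ → Bool) (y m : ℕ) (a : Bool) :
    (List.range' (y + 1) m).filter (Function.update u y a) = (List.range' (y + 1) m).filter u := by
  apply List.filter_congr
  intro x hx
  rw [Function.update_of_ne]
  have := List.mem_range'_1.1 hx
  omega

theorem col_insert (n : ℕ) (u : ℕ → Bool) (y : ℕ) (hy : y < 2 * n) (hu : u y = false) :
    (col n u).take (cnt u y) ++ y :: (col n u).drop (cnt u y) = col n (Function.update u y true) := by
  unfold col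
  rw [range_split _ y hy, List.filter_append, List.filter_append, List.filter_cons, List.filter_cons,
    filter_update_lo, filter_update_hi, ← length_filter_range]
  simp [hu]

theorem col_erase (n : ℕ) (u : ℕ → Bool) (y : ℕ) (hy : y < 2 * n) (hu : u y = true) :
    (col n u).eraseIdx (cnt u y) = col n (Function.update u y false) := by
  unfold col
  rw [range_split _ y hy, List.filter_append, List.filter_append, List.filter_cons, List.filter_cons,
    filter_update_lo, filter_update_hi, ← length_filter_range,
    List.eraseIdx_append_of_length_le le_rfl]
  simp [hu]

theorem last_rec (r : ℕ → Bool) (N b : ℕ) (h : cnt r N = b + 1) :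
    ∃ y, y < N ∧ r y = true ∧ cnt r y = b ∧ ∀ z, y < z → z < N → r z = false := by
  obtain ⟨y, h1, h2, h3⟩ := exists_cnt r N b (by omega)
  refine ⟨y, h1, h2, h3, ?_⟩
  intro z hz hz2
  by_contra hc
  have h4 := cnt_mono r (show y + 1 ≤ z from hz)
  have h5 := cnt_mono r (show z + 1 ≤ N from hz2)
  simp only [Bool.not_eq_false] at hc
  simp [cnt, h2, hc] at h4 h5
  omega

theorem rec1_spec {u v : ℕ → Bool} {y : ℕ} (h : rec1 u v y = true) :
    v y = true ∧ u y = false ∧ gap u v y = 0 := by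
  simp only [rec1, Bool.and_eq_true, Bool.not_eq_true', decide_eq_true_eq] at h
  tauto

theorem Fop_step (n b : ℕ) (u v : ℕ → Bool) (y : ℕ) (hy : y < 2 * n)
    (hr : rec1 u v y = true) (hb : cnt (rec1 u v) y = b) :
    Fop (b + 1, col n u, col n v) =
      some (b, col n (Function.update u y true), col n (Function.update v y false)) := by
  obtain ⟨hv, hu, hg⟩ := rec1_spec hr
  have hi := inv1 u v y
  rw [hg, hb] at hi
  have hR : (col n v)[b + cnt u y]? = some y := by
    rw [get_col]; exact ⟨hy, hv, by omega⟩
  have hfind : (List.range ((col n u).length + 1)).find?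
      (fun i => FCond (b + 1) (col n u) (col n v) i) = some (cnt u y) := by
    rw [List.find?_range_eq_some]
    refine ⟨?_, ?_, ?_⟩
    · simp only [FCond, Nat.add_sub_cancel, hR]
      cases hL : (col n u)[cnt u y]? with
      | none => rfl
      | some x =>
        rw [get_col] at hL
        simp only [decide_eq_true_eq]
        by_contra hc
        rcases Nat.lt_or_ge x y with h | h
        · have := cnt_mono u (show x + 1 ≤ y from h)
          simp [cnt, hL.2.1] at this
          omega
        · have : x = y := by omega
          subst this
          simp [hu] at hL
    · rw [List.mem_range, length_col]
      have := cnt_mono u hy.le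
      omega
    · intro j hj
      simp only [FCond, Nat.add_sub_cancel]
      cases hL : (col n u)[j]? with
      | none =>
        rw [List.getElem?_eq_none_iff, length_col] at hL
        have := cnt_mono u hy.le
        omega
      | some x =>
        rw [get_col] at hL
        cases hz : (col n v)[b + j]? with
        | none => rfl
        | some z =>
          rw [get_col] at hz
          simp only [Bool.not_eq_true', decide_eq_false_iff_not]
          intro hzx
          have hxy : x < y := by
            by_contra hc
            have := cnt_mono u (show y ≤ x by omega)
            omega
          have h1 := inv1 u v (z + 1)
          have h2 := cnt_mono u (show z + 1 ≤ x from hzx)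
          have h3 := cnt_mono (rec1 u v) (show z + 1 ≤ y by omega)
          have h4 : cnt v (z + 1) = cnt v z + 1 := by simp [cnt, hz.2.1]
          omega
  simp only [Fop]
  rw [hfind]
  simp only [Nat.add_sub_cancel, hR, Nat.add_eq_zero_iff, one_ne_zero, and_false, if_false]
  rw [col_insert n u y hy hu, show b + cnt u y = cnt v y by omega, col_erase n v y hy hv]

theorem gap_step (u v : ℕ → Bool) (y N : ℕ) (hr : rec1 u v y = true)
    (hl : ∀ z, y < z → z < N → rec1 u v z = false) :
    (∀ x ≤ y, gap (Function.update u y true) (Function.update v y false) x = gap u v x) ∧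
    (∀ x, y < x → x ≤ N → gap (Function.update u y true) (Function.update v y false) x
      = gap u v x + 1) := by
  obtain ⟨hv, hu, hg⟩ := rec1_spec hr
  have h1 : ∀ x ≤ y, gap (Function.update u y true) (Function.update v y false) x = gap u v x := by
    apply gap_congr
    intro x hx
    simp [Function.update_of_ne (show x ≠ y by omega)]
  refine ⟨h1, ?_⟩
  intro x
  induction x with
  | zero => intro h; omega
  | succ x ih =>
    intro hx hN
    rcases Nat.lt_or_ge y x with h | h
    · have := ih h (by omega)
      have hl' := hl x h (by omega)
      simp only [gap, this, Function.update_of_ne (show x ≠ y by omega)]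
      simp only [rec1] at hl'
      cases hu : u x <;> cases hv : v x <;> simp_all
      omega
    · have : x = y := by omega
      subst this
      simp [gap, h1 x le_rfl, hg, hu, hv]

theorem rec_step (u v : ℕ → Bool) (y N : ℕ) (hr : rec1 u v y = true)
    (hl : ∀ z, y < z → z < N → rec1 u v z = false) :
    ∀ x < N, rec1 (Function.update u y true) (Function.update v y false) x =
      (rec1 u v x && decide (x ≠ y)) := by
  obtain ⟨hv, hu, hg⟩ := rec1_spec hr
  obtain ⟨h1, h2⟩ := gap_step u v y N hr hl
  intro x hx
  rcases lt_trichotomy x y with h | h | h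
  · have hne : x ≠ y := by omega
    simp only [rec1, h1 x h.le, Function.update_of_ne hne]
    simp [hne]
  · subst h
    simp [rec1]
  · have hne : x ≠ y := by omega
    rw [hl x h hx]
    simp only [rec1, h2 x h hx.le]
    simp

theorem cnt_congr {u v : ℕ → Bool} (N : ℕ) (h : ∀ x < N, u x = v x) : cnt u N = cnt v N := by
  induction N with
  | zero => rfl
  | succ N ih => simp only [cnt, ih (fun x hx => h x (by omega)), h N (by omega)]

theorem iter_Fop (n b : ℕ) : ∀ (u v : ℕ → Bool), cnt (rec1 u v) (2 * n) = b →
    iterO Fop b (b, col n u, col n v) = some (0, col n (outU u v), col n (outV u v)) := by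
  induction b with
  | zero =>
    intro u v h
    have hr : ∀ x < 2 * n, rec1 u v x = false := by
      intro x hx
      have := cnt_mono (rec1 u v) (show x + 1 ≤ 2 * n from hx)
      simp only [cnt] at this
      cases hc : rec1 u v x
      · rfl
      · simp [hc] at this; omega
    simp only [iterO]
    congr 3
    · apply List.filter_congr
      intro x hx
      simp [outU, hr x (List.mem_range.1 hx)]
    · apply List.filter_congr
      intro x hx
      simp [outV, hr x (List.mem_range.1 hx)]
  | succ b ih =>
    intro u v h
    obtain ⟨y, hy, hr, hb, hl⟩ := last_rec _ _ _ h
    obtain ⟨hv, hu, hg⟩ := rec1_spec hr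
    simp only [iterO]
    rw [Fop_step n b u v y hy hr hb, Option.bind_some, ih]
    · have hs := rec_step u v y (2 * n) hr hl
      congr 3
      · apply List.filter_congr
        intro x hx
        simp only [outU, hs x (List.mem_range.1 hx)]
        by_cases hxy : x = y
        · subst hxy; simp [hr]
        · simp [hxy]
      · apply List.filter_congr
        intro x hx
        simp only [outV, hs x (List.mem_range.1 hx)]
        by_cases hxy : x = y
        · subst hxy; simp [hr]
        · simp [hxy]
    · have hs := rec_step u v y (2 * n) hr hl
      have hs' : ∀ x ≤ 2 * n, cnt (rec1 (Function.update u y true) (Function.update v y false)) x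
          + (decide (y < x)).toNat = cnt (rec1 u v) x := by
        intro x
        induction x with
        | zero => intro _; simp [cnt]
        | succ x ihx =>
          intro hx
          have := ihx (by omega)
          simp only [cnt, hs x (by omega)]
          rcases lt_trichotomy x y with h | h | h
          · have h5 : ¬ y < x + 1 := by omega
            have h6 : ¬ y < x := by omega
            simp [h.ne, h5, h6] at *
            omega
          · subst h
            simp [hr] at *
            omega
          · have h5 : y < x + 1 := by omega
            simp [h.ne', h5, h] at *
            omega
      have := hs' (2 * n) le_rfl
      simp [hy] at this
      omega

/-- The column over `𝕁_n^×` associated with the two indicator functions. -/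
def toT (n : ℕ) (u v : ℕ → Bool) (x : ℕ) : Bool :=
  if x < n then !v (2 * n - 1 - x) else u x

def Supp (n : ℕ) (u : ℕ → Bool) : Prop := ∀ x, u x = true → n ≤ x ∧ x < 2 * n

theorem Supp.cnt {n : ℕ} {u : ℕ → Bool} (h : Supp n u) : ∀ x ≤ n, cnt u x = 0 := by
  intro x
  induction x with
  | zero => intro _; rfl
  | succ x ih =>
    intro hx
    have : u x = false := by
      by_contra hc
      have := h x (by simpa using hc)
      omega
    simp [KN.cnt, this, ih (by omega)]

theorem refl_cnt (n : ℕ) (u v : ℕ → Bool) : ∀ c ≤ n,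
    (cnt v (2 * n) : ℤ) - cnt v (2 * n - c) - (cnt u (2 * n) - cnt u (2 * n - c)) =
      c - cnt (toT n u v) c - cnt (toT n u v) (2 * n) + cnt (toT n u v) (2 * n - c) := by
  intro c
  induction c with
  | zero => intro _; simp [cnt]
  | succ c ih =>
    intro hc
    have h := ih (by omega)
    obtain ⟨m, hm⟩ : ∃ m, 2 * n - c = m + 1 := ⟨2 * n - c - 1, by omega⟩
    have hm' : 2 * n - (c + 1) = m := by omega
    have e1 : toT n u v c = !v m := by
      simp only [toT, if_pos (show c < n by omega)]
      congr 2; omega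
    have e2 : toT n u v m = u m := by
      simp only [toT, if_neg (show ¬ m < n by omega)]
    rw [hm] at h
    rw [hm']
    simp only [cnt, e1, e2] at h ⊢
    cases hu : u m <;> cases hv : v m <;> simp [hu, hv] at h ⊢ <;> omega

theorem refl_cnt_n (n : ℕ) (u v : ℕ → Bool) (hu : Supp n u) (hv : Supp n v) :
    (cnt v (2 * n) : ℤ) - cnt u (2 * n) = n - cnt (toT n u v) (2 * n) := by
  have h := refl_cnt n u v n le_rfl
  rw [show 2 * n - n = n by omega, hu.cnt n le_rfl, hv.cnt n le_rfl] at h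
  push_cast at h
  omega

theorem filterMap_aux (n : ℕ) (v : ℕ → Bool) (f : ℕ → Option ℕ) (l : List ℕ)
    (h : ∀ j ∈ l, f j = if v (n + j) then some (n + j) else none) :
    l.filterMap f = (l.map (n + ·)).filter v := by
  induction l with
  | nil => rfl
  | cons j l ih =>
    have h1 := h j (by simp)
    have h2 := ih (fun j hj => h j (by simp [hj]))
    cases hv : v (n + j) <;> simp [hv] at h1 <;> simp [h1, h2, hv]

theorem mem_col (n : ℕ) (u : ℕ → Bool) (x : ℕ) : x ∈ col n u ↔ x < 2 * n ∧ u x = true := by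
  simp [col, List.mem_filter]

theorem PsiCol_toT (n : ℕ) (u v : ℕ → Bool) (hu : Supp n u) (hv : Supp n v)
    (hg : gap u v (2 * n) = 0) :
    PsiCol n (col n (toT n u v)) = (col n (outU u v), col n (outV u v)) := by
  have hU : (col n (toT n u v)).filter (fun x => decide (n ≤ x)) = col n u := by
    unfold col
    rw [List.filter_filter]
    apply List.filter_congr
    intro x hx
    by_cases h : n ≤ x
    · simp [toT, h]
    · cases hc : u x
      · simp [h]
      · exact absurd (hu x hc).1 h
  have hV : ((List.range n).filterMap fun j =>
      let k := n - j
      if (col n (toT n u v)).contains (k - 1) then none else some (2 * n - k)) = col n v := by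
    rw [filterMap_aux n v]
    · unfold col
      rw [two_mul, List.range_add, List.filter_append]
      have : (List.range n).filter v = [] := by
        rw [List.filter_eq_nil_iff]
        intro x hx hc
        have := hv x hc
        have := List.mem_range.1 hx
        omega
      rw [this, List.nil_append]
    · intro j hj
      have hj := List.mem_range.1 hj
      have e1 : 2 * n - (n - j) = n + j := by omega
      have e2 : 2 * n - 1 - (n - j - 1) = n + j := by omega
      have e3 : n - j - 1 < n := by omega
      have e4 : n - j - 1 < 2 * n := by omega
      have : (col n (toT n u v)).contains (n - j - 1) = !v (n + j) := by
        rw [Bool.eq_iff_iff, List.contains_iff_mem, mem_col]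
        simp only [toT, if_pos e3, e2, e4, true_and]
      simp only [this, e1]
      cases v (n + j) <;> simp
  have hlen := refl_cnt_n n u v hu hv
  have hinv := inv1 u v (2 * n)
  rw [hg] at hinv
  have hb : n - (col n (toT n u v)).length = cnt (rec1 u v) (2 * n) := by
    rw [length_col]; omega
  have hoff : pairOffset (col n u) (col n v) = cnt (rec1 u v) (2 * n) := by
    unfold pairOffset
    have : (List.range ((col n v).length + 1)).find? (fun b =>
      decide ((col n v).length ≤ (col n u).length + b) && ssdB b (col n u) (col n v)) =
        some (cnt (rec1 u v) (2 * n)) := by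
      rw [List.find?_range_eq_some]
      refine ⟨?_, ?_, ?_⟩
      · simp only [length_col, Bool.and_eq_true, decide_eq_true_eq]
        refine ⟨by omega, ?_⟩
        simp only [ssdB, List.all_eq_true]
        intro i _
        cases hx : (col n u)[i]? with
        | none => rfl
        | some x =>
          cases hy : (col n v)[cnt (rec1 u v) (2 * n) + i]? with
          | none => rfl
          | some y =>
            rw [get_col] at hx hy
            simp only [decide_eq_true_eq]
            by_contra hc
            have h1 := gap_ub u v (2 * n) (y + 1) (by omega)
            have h2 := cnt_mono u (show y + 1 ≤ x by omega)
            have h3 : cnt v (y + 1) = cnt v y + 1 := by simp [cnt, hy.2.1]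
            omega
      · rw [List.mem_range, length_col]; omega
      · intro j hj
        have : ¬ ((col n v).length ≤ (col n u).length + j) := by
          simp only [length_col]; omega
        simp [this]
    rw [this]
  unfold PsiCol
  simp only [hU]
  simp only [] at hV
  rw [hV, hoff, hb, iter_Fop n _ u v rfl]

end KN
namespace KN

theorem col_chain (n : ℕ) (u : ℕ → Bool) : (col n u).Chain' (· < ·) :=
  List.isChain_iff_pairwise.2 ((List.pairwise_lt_range (n := 2 * n)).filter u)

theorem eq_col (n : ℕ) (l : List ℕ) (h : l.Chain' (· < ·)) (hb : ∀ x ∈ l, x < 2 * n) :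
    l = col n (fun x => decide (x ∈ l)) := by
  have h1 : l.Pairwise (· < ·) := List.isChain_iff_pairwise.1 h
  have h2 : (col n (fun x => decide (x ∈ l))).Pairwise (· < ·) :=
    List.isChain_iff_pairwise.1 (col_chain n _)
  apply List.Perm.eq_of_pairwise (le := (· < ·)) _ h1 h2
  · rw [List.perm_ext_iff_of_nodup (h1.imp (fun h => Nat.ne_of_lt h)) (h2.imp (fun h => Nat.ne_of_lt h))]
    intro x
    rw [mem_col]
    simp only [decide_eq_true_eq]
    exact ⟨fun h => ⟨hb x h, h⟩, fun h => h.2⟩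
  · intro a b _ _ h3 h4; omega

theorem col_congr {n : ℕ} {u v : ℕ → Bool} (h : ∀ x < 2 * n, u x = v x) : col n u = col n v := by
  apply List.filter_congr
  intro x hx
  exact h x (List.mem_range.1 hx)

theorem col_inj {n : ℕ} {u v : ℕ → Bool} (h : col n u = col n v) : ∀ x < 2 * n, u x = v x := by
  intro x hx
  have h1 := mem_col n u x
  rw [h, mem_col] at h1
  rw [Bool.eq_iff_iff]
  tauto

theorem exists_toT (n : ℕ) (l : List ℕ) (h : l.Chain' (· < ·)) (hb : ∀ x ∈ l, x < 2 * n) :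
    ∃ u v, Supp n u ∧ Supp n v ∧ l = col n (toT n u v) := by
  refine ⟨fun x => decide (x ∈ l ∧ n ≤ x ∧ x < 2 * n),
    fun x => decide (2 * n - 1 - x ∉ l ∧ n ≤ x ∧ x < 2 * n), ?_, ?_, ?_⟩
  · intro x hx; simp at hx; omega
  · intro x hx; simp at hx; omega
  · conv_lhs => rw [eq_col n l h hb]
    apply col_congr
    intro x hx
    by_cases hxn : x < n
    · have e : 2 * n - 1 - (2 * n - 1 - x) = x := by omega
      have e1 : n ≤ 2 * n - 1 - x := by omega
      have e2 : 2 * n - 1 - x < 2 * n := by omega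
      simp only [toT, hxn, if_true, e, e1, e2]
      simp
    · simp only [toT, hxn, if_false, hx]
      simp; omega

theorem getB_col (n : ℕ) (t : ℕ → Bool) (i x : ℕ) :
    getB (col n t) i = some x ↔ (x < 2 * n ∧ t x = true ∧ cnt t x + i = cnt t (2 * n)) := by
  unfold getB
  split_ifs with h
  · rw [get_col, length_col]
    rw [length_col] at h
    constructor
    · rintro ⟨h1, h2, h3⟩; exact ⟨h1, h2, by omega⟩
    · rintro ⟨h1, h2, h3⟩; exact ⟨h1, h2, by omega⟩
  · simp only [reduceCtorEq, false_iff, not_and]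
    intro h1 h2 h3
    rw [length_col] at h
    have h4 := cnt_mono t (show x + 1 ≤ 2 * n from h1)
    simp [cnt, h2] at h4
    omega

theorem KN1_iff (n : ℕ) (u v : ℕ → Bool) (hu : Supp n u) (hv : Supp n v) :
    KN1 n (cnt (toT n u v) (2 * n)) (col n (toT n u v)) ↔ gap u v (2 * n) = 0 := by
  constructor
  · intro h
    have key : ∀ c ≤ n, (0 : ℤ) ≤
      c - cnt (toT n u v) c - cnt (toT n u v) (2 * n) + cnt (toT n u v) (2 * n - c) := by
      intro c
      induction c with
      | zero => intro _; simp [cnt]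
      | succ c ih =>
        intro hc
        have h0 := ih (by omega)
        obtain ⟨m, hm⟩ : ∃ m, 2 * n - c = m + 1 := ⟨2 * n - c - 1, by omega⟩
        have hm' : 2 * n - (c + 1) = m := by omega
        rw [hm] at h0
        rw [hm']
        by_cases hb : toT n u v c = true ∧ toT n u v m = true
        · have hle := cnt_mono (toT n u v) (show m + 1 ≤ 2 * n by omega)
          have hle2 := cnt_mono (toT n u v) (show c + 1 ≤ m by omega)
          have := h (c + 1) (cnt (toT n u v) (2 * n) - cnt (toT n u v) m)
            (cnt (toT n u v) (2 * n) - cnt (toT n u v) c) (by omega) hc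
            (by
              rw [hm', getB_col]
              simp only [cnt, hb] at hle
              exact ⟨by omega, hb.2, by omega⟩)
            (by
              rw [Nat.add_sub_cancel, getB_col]
              simp only [cnt, hb] at hle hle2
              exact ⟨by omega, hb.1, by omega⟩)
            (by
              simp [cnt, hb] at hle hle2
              omega)
          simp [cnt, hb] at hle hle2 ⊢
          omega
        · simp only [cnt] at h0 ⊢
          cases h1 : toT n u v c <;> cases h2 : toT n u v m <;> simp_all <;> omega
    obtain ⟨y, hy, hatt⟩ := gap_att u v (2 * n)
    have hn := key n le_rfl
    have hrn := refl_cnt n u v n le_rfl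
    rw [show 2 * n - n = n by omega] at hn hrn
    rw [hu.cnt n le_rfl, hv.cnt n le_rfl] at hrn
    rcases Nat.lt_or_ge n y with hyn | hyn
    · have h1 := key (2 * n - y) (by omega)
      have h2 := refl_cnt n u v (2 * n - y) (by omega)
      rw [show 2 * n - (2 * n - y) = y by omega] at h1 h2
      omega
    · rw [hu.cnt y hyn, hv.cnt y hyn] at hatt
      omega
  · intro h c i₁ i₂ hc1 hcn h1 h2 _
    rw [getB_col] at h1 h2
    have h3 := gap_ub u v (2 * n) (2 * n - c) (by omega)
    have h4 := refl_cnt n u v c hcn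
    have h5 : cnt (toT n u v) c = cnt (toT n u v) (c - 1) + 1 := by
      obtain ⟨m, rfl⟩ : ∃ m, c = m + 1 := ⟨c - 1, by omega⟩
      simp only [Nat.add_sub_cancel] at h2 ⊢
      simp [cnt, h2.2.1]
    omega

theorem mem_KN_toT (n a : ℕ) (u v : ℕ → Bool) (hu : Supp n u) (hv : Supp n v) :
    col n (toT n u v) ∈ KNcolC n a ↔ cnt (toT n u v) (2 * n) = a ∧ gap u v (2 * n) = 0 := by
  simp only [KNcolC, Set.mem_setOf_eq, length_col]
  constructor
  · rintro ⟨rfl, _, _, h⟩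
    exact ⟨rfl, (KN1_iff n u v hu hv).1 h⟩
  · rintro ⟨rfl, h⟩
    exact ⟨rfl, col_chain _ _, fun x hx => ((mem_col _ _ _).1 hx).1, (KN1_iff n u v hu hv).2 h⟩

theorem Supp.outU {n : ℕ} {u v : ℕ → Bool} (hu : Supp n u) (hv : Supp n v) : Supp n (outU u v) := by
  intro x hx
  simp only [KN.outU, rec1, Bool.or_eq_true, Bool.and_eq_true] at hx
  rcases hx with h | h
  · exact hu x h
  · exact hv x h.1.1

theorem Supp.outV {n : ℕ} {u v : ℕ → Bool} (hv : Supp n v) : Supp n (outV u v) := by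
  intro x hx
  simp only [KN.outV, Bool.and_eq_true] at hx
  exact hv x hx.1

theorem mem_TCn (n m : ℕ) (p q : ℕ → Bool) (hp : Supp n p) (hq : Supp n q) :
    (col n p, col n q) ∈ TCnSet n m ↔
      cnt p (2 * n) = cnt q (2 * n) + m ∧ ∀ x ≤ 2 * n, cnt q x ≤ cnt p x := by
  simp only [TCnSet, Set.mem_setOf_eq, length_col]
  constructor
  · rintro ⟨h1, ⟨_, _, h2⟩, _⟩
    refine ⟨h1, ?_⟩
    intro x hx
    by_contra hc
    obtain ⟨y, hy1, hy2, hy3⟩ := exists_cnt q x (cnt p x) (by omega)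
    have := cnt_mono q hx
    obtain ⟨z, hz1, hz2, hz3⟩ := exists_cnt p (2 * n) (cnt p x) (by omega)
    have h3 := h2 (cnt p x) z y ((get_col _ _ _ _).2 ⟨hz1, hz2, hz3⟩)
      ((get_col _ _ _ _).2 ⟨by omega, hy2, by omega⟩)
    have h4 := cnt_mono p (show z + 1 ≤ x by omega)
    simp [cnt, hz2] at h4
    omega
  · rintro ⟨h1, h2⟩
    refine ⟨h1, ⟨col_chain _ _, col_chain _ _, ?_⟩, ?_, ?_⟩
    · intro i x y hx hy
      rw [get_col] at hx hy
      by_contra hc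
      have h3 := h2 (y + 1) (by omega)
      have h4 := cnt_mono p (show y + 1 ≤ x by omega)
      simp [cnt, hy.2.1] at h3 h4
      omega
    · intro x hx; exact hp x ((mem_col _ _ _).1 hx).2
    · intro x hx; exact hq x ((mem_col _ _ _).1 hx).2

theorem out_mem (n a : ℕ) (ha : a < n) (u v : ℕ → Bool) (hu : Supp n u) (hv : Supp n v)
    (hT : col n (toT n u v) ∈ KNcolC n a) :
    (col n (outU u v), col n (outV u v)) ∈ TCnSet n (n - a) := by
  rw [mem_KN_toT n a u v hu hv] at hT
  rw [mem_TCn _ _ _ _ (hu.outU hv) hv.outV]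
  have h1 := refl_cnt_n n u v hu hv
  constructor
  · have := inv1 u v (2 * n)
    have := inv2 u v (2 * n)
    have := inv3 u v (2 * n)
    omega
  · intro x hx
    have := inv1 u v x
    have := inv2 u v x
    have := inv3 u v x
    omega

theorem wt_col_aux (n k : ℕ) (hk : 1 ≤ k) (hkn : k ≤ n) (u : ℕ → Bool) (N : ℕ) :
    wtList n ((List.range N).filter u) k =
      (if k - 1 < N ∧ u (k - 1) = true then 1 else 0)
        - (if 2 * n - k < N ∧ u (2 * n - k) = true then 1 else 0) := by
  induction N with
  | zero => simp [wtList]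
  | succ N ih =>
    have : wtList n ((List.range (N + 1)).filter u) k =
      wtList n ((List.range N).filter u) k + (if u N = true then wtBox n N k else 0) := by
      rw [List.range_succ, List.filter_append]
      cases h : u N <;> simp [wtList, h]
    rw [this, ih]
    unfold wtBox
    rcases lt_trichotomy (k - 1) N with h1 | h1 | h1
    · rcases lt_trichotomy (2 * n - k) N with h2 | h2 | h2
      · simp [h1, h2, show k - 1 < N + 1 by omega, show 2 * n - k < N + 1 by omega,
          show ¬ N + 1 = k by omega, show ¬ N + k = 2 * n by omega]
      · simp [h1, h2, show k - 1 < N + 1 by omega,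
          show ¬ N + 1 = k by omega, show N + k = 2 * n by omega]
        split_ifs <;> simp
      · simp [h1, show ¬ 2 * n - k < N by omega, show k - 1 < N + 1 by omega,
          show ¬ 2 * n - k < N + 1 by omega,
          show ¬ N + 1 = k by omega, show ¬ N + k = 2 * n by omega]
    · simp [h1, show ¬ 2 * n - k < N by omega, show ¬ 2 * n - k < k by omega,
          show N + 1 = k by omega, show N < k by omega]
    · simp [show ¬ k - 1 < N by omega, show ¬ k - 1 < N + 1 by omega,
          show ¬ 2 * n - k < N by omega,
          show ¬ 2 * n - k < N + 1 by omega,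
          show ¬ N + 1 = k by omega, show ¬ N + k = 2 * n by omega]

theorem wt_col (n k : ℕ) (hk : 1 ≤ k) (hkn : k ≤ n) (u : ℕ → Bool) :
    wtList n (col n u) k = (u (k - 1)).toNat - (u (2 * n - k)).toNat := by
  unfold col
  rw [wt_col_aux n k hk hkn]
  simp only [show k - 1 < 2 * n by omega, show 2 * n - k < 2 * n by omega]
  cases u (k - 1) <;> cases u (2 * n - k) <;> simp

theorem wt_main (n k : ℕ) (hk : 1 ≤ k) (hkn : k ≤ n) (u v : ℕ → Bool)
    (hu : Supp n u) (hv : Supp n v) :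
    1 + wtList n (col n (outU u v) ++ col n (outV u v)) k = wtList n (col n (toT n u v)) k := by
  have h : wtList n (col n (outU u v) ++ col n (outV u v)) k =
      wtList n (col n (outU u v)) k + wtList n (col n (outV u v)) k := by
    simp [wtList]
  rw [h, wt_col n k hk hkn, wt_col n k hk hkn, wt_col n k hk hkn]
  have h1 : outU u v (k - 1) = false := by
    by_contra hc
    have := hu.outU hv (k - 1) (by simpa using hc)
    omega
  have h2 : outV u v (k - 1) = false := by
    by_contra hc
    have := hv.outV (u := u) (k - 1) (by simpa using hc)
    omega
  have h3 : toT n u v (k - 1) = !v (2 * n - k) := by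
    simp only [toT, if_pos (show k - 1 < n by omega)]
    congr 2; omega
  have h4 : toT n u v (2 * n - k) = u (2 * n - k) := by
    simp only [toT, if_neg (show ¬ 2 * n - k < n by omega)]
  rw [h1, h2, h3, h4]
  simp only [outU, outV, rec1]
  by_cases hg : gap u v (2 * n - k) = 0 <;>
    cases u (2 * n - k) <;> cases v (2 * n - k) <;> simp [hg]

theorem psi_bij (n a : ℕ) (ha : a < n) : Set.BijOn (PsiCol n) (KNcolC n a) (TCnSet n (n - a)) := by
  refine ⟨?_, ?_, ?_⟩
  · intro T hT
    obtain ⟨u, v, hu, hv, rfl⟩ := exists_toT n T hT.2.1 hT.2.2.1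
    rw [PsiCol_toT n u v hu hv ((mem_KN_toT n a u v hu hv).1 hT).2]
    exact out_mem n a ha u v hu hv hT
  · intro T hT T' hT' heq
    obtain ⟨u, v, hu, hv, rfl⟩ := exists_toT n T hT.2.1 hT.2.2.1
    obtain ⟨u2, v2, hu2, hv2, rfl⟩ := exists_toT n T' hT'.2.1 hT'.2.2.1
    rw [mem_KN_toT n a _ _ (by assumption) (by assumption)] at hT hT'
    rw [PsiCol_toT n u v hu hv hT.2, PsiCol_toT n u2 v2 hu2 hv2 hT'.2, Prod.mk.injEq] at heq
    have h := out_inj u v u2 v2 (2 * n) (by rw [hT.2, hT'.2])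
      (fun x hx => ⟨col_inj heq.1 x hx, col_inj heq.2 x hx⟩)
    apply col_congr
    intro x hx
    simp only [toT]
    rw [(h x hx).1, (h (2 * n - 1 - x) (by omega)).2]
  · rintro ⟨L, R⟩ hp
    have hp' := hp
    obtain ⟨_, ⟨hL, hR, _⟩, hL2, hR2⟩ := hp'
    rw [eq_col n L hL (fun x hx => (hL2 x hx).2), eq_col n R hR (fun x hx => (hR2 x hx).2)] at hp ⊢
    have hsp : Supp n (fun x => decide (x ∈ L)) := fun x hx => hL2 x (by simpa using hx)
    have hsq : Supp n (fun x => decide (x ∈ R)) := fun x hx => hR2 x (by simpa using hx)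
    rw [mem_TCn _ _ _ _ hsp hsq] at hp
    generalize (fun x => decide (x ∈ L)) = p at *
    generalize (fun x => decide (x ∈ R)) = q at *
    obtain ⟨u0, v0, h1, h2⟩ := out_surj p q (2 * n) hp.2
    let u : ℕ → Bool := fun x => u0 x && decide (x < 2 * n)
    let v : ℕ → Bool := fun x => v0 x && decide (x < 2 * n)
    have hg : ∀ x ≤ 2 * n, gap u v x = gap u0 v0 x := by
      apply gap_congr
      intro x hx; simp [u, v, hx]
    have h2' : ∀ x < 2 * n, outU u v x = p x ∧ outV u v x = q x := by
      intro x hx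
      have := h2 x hx
      simp only [outU, outV, rec1, hg x hx.le] at *
      simpa [u, v, hx] using this
    have hsu : Supp n u := by
      intro x hx
      have hx2 : x < 2 * n := by simp [u] at hx; exact hx.2
      refine ⟨(hsp x ?_).1, hx2⟩
      rw [← (h2' x hx2).1]; simp [outU, hx]
    have hsv : Supp n v := by
      intro x hx
      have hx2 : x < 2 * n := by simp [v] at hx; exact hx.2
      refine ⟨?_, hx2⟩
      cases hr : rec1 u v x
      · refine (hsq x ?_).1
        rw [← (h2' x hx2).2]; simp [outV, hx, hr]
      · refine (hsp x ?_).1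
        rw [← (h2' x hx2).1]; simp [outU, hr]
    have hg0 : gap u v (2 * n) = 0 := by rw [hg _ le_rfl, h1]
    refine ⟨col n (toT n u v), ?_, ?_⟩
    · rw [mem_KN_toT n a u v hsu hsv]
      refine ⟨?_, hg0⟩
      have e0 := refl_cnt_n n u v hsu hsv
      have e1 := inv1 u v (2 * n)
      have e2 := inv2 u v (2 * n)
      have e3 := inv3 u v (2 * n)
      have e4 := cnt_congr (2 * n) (fun x hx => (h2' x hx).1)
      have e5 := cnt_congr (2 * n) (fun x hx => (h2' x hx).2)
      omega
    · rw [PsiCol_toT n u v hsu hsv hg0]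
      rw [col_congr (fun x hx => (h2' x hx).1), col_congr (fun x hx => (h2' x hx).2)]

end KN
namespace KN

def Irr (n i x : ℕ) : Prop := boxCe n i x = none ∧ boxCf n i x = none

theorem listEps_nonneg (n i : ℕ) (w : List ℕ) : 0 ≤ listEps (boxC n) i w := by
  cases w with
  | nil => simp [listEps]
  | cons x xs =>
    simp only [listEps, boxC]
    apply le_max_of_le_left
    split_ifs <;> simp

theorem listE_none (n i : ℕ) (w : List ℕ) (h : listEps (boxC n) i w = 0) :
    listE (boxC n) i w = none := by
  induction w with
  | nil => rfl
  | cons x xs ih =>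
    have h0 := listEps_nonneg n i xs
    simp only [listEps] at h
    have h1 : (boxC n).eps x i ≤ 0 := h ▸ le_max_left _ _
    have h2 : listEps (boxC n) i xs - ((boxC n).phi x i - (boxC n).eps x i) ≤ 0 :=
      h ▸ le_max_right _ _
    have h3 : boxCe n i x = none := by
      simp only [boxC] at h1
      cases hc : boxCe n i x
      · rfl
      · simp [hc] at h1
    have h4 : (boxC n).eps x i = 0 := by simp [boxC, h3]
    simp only [listE]
    rw [if_pos (by omega)]
    simp [boxC, h3]

theorem irr_eps (n i x : ℕ) (w : List ℕ) (h : Irr n i x) :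
    listEps (boxC n) i (x :: w) = listEps (boxC n) i w := by
  have h0 := listEps_nonneg n i w
  simp only [listEps, boxC, h.1, h.2]
  simpa [boxC] using h0

theorem irr_E (n i x : ℕ) (w : List ℕ) (h : Irr n i x) :
    listE (boxC n) i (x :: w) = (listE (boxC n) i w).map (x :: ·) := by
  have h0 := listEps_nonneg n i w
  simp only [listE]
  split_ifs with h1
  · simp only [boxC, h.2] at h1
    rw [listE_none n i w (by simp only [boxC] at h0 ⊢; simp at h1; omega)]
    simp [boxC, h.1]
  · rfl

theorem irr_F (n i x : ℕ) (w : List ℕ) (h : Irr n i x) :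
    listF (boxC n) i (x :: w) = (listF (boxC n) i w).map (x :: ·) := by
  have h0 := listEps_nonneg n i w
  simp only [listF]
  rw [if_neg]
  have : (boxC n).phi x i = 0 := by simp [boxC, h.2]
  omega

theorem irrs_eps (n i : ℕ) (A w : List ℕ) (h : ∀ x ∈ A, Irr n i x) :
    listEps (boxC n) i (A ++ w) = listEps (boxC n) i w := by
  induction A with
  | nil => rfl
  | cons x A ih =>
    rw [List.cons_append, irr_eps _ _ _ _ (h x (by simp)), ih (fun x hx => h x (by simp [hx]))]

theorem irrs_E (n i : ℕ) (A w : List ℕ) (h : ∀ x ∈ A, Irr n i x) :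
    listE (boxC n) i (A ++ w) = (listE (boxC n) i w).map (A ++ ·) := by
  induction A with
  | nil => simp
  | cons x A ih =>
    rw [List.cons_append, irr_E _ _ _ _ (h x (by simp)), ih (fun x hx => h x (by simp [hx]))]
    simp [Function.comp_def]

theorem irrs_F (n i : ℕ) (A w : List ℕ) (h : ∀ x ∈ A, Irr n i x) :
    listF (boxC n) i (A ++ w) = (listF (boxC n) i w).map (A ++ ·) := by
  induction A with
  | nil => simp
  | cons x A ih =>
    rw [List.cons_append, irr_F _ _ _ _ (h x (by simp)), ih (fun x hx => h x (by simp [hx]))]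
    simp [Function.comp_def]

def bl (lo hi : ℕ) (p q : Bool) : List ℕ :=
  (if p then [lo] else []) ++ (if q then [hi] else [])

abbrev B4 := Bool × Bool × Bool × Bool

def sE : B4 → Option B4
  | (p, q, p', q') =>
    if !p' && q' && !(p && !q) then some (p, q, true, false)
    else if !p && q then some (true, false, p', q') else none

def sF : B4 → Option B4
  | (p, q, p', q') =>
    if p && !q && !(!p' && q') then some (false, true, p', q')
    else if p' && !q' then some (p, q, false, true) else none

def word (A M B : List ℕ) (lo hi lo' hi' : ℕ) : B4 → List ℕ
  | (p, q, p', q') => A ++ (bl lo hi p q ++ (M ++ (bl lo' hi' p' q' ++ B)))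

def LoHi (n i lo hi : ℕ) : Prop :=
  boxCe n i lo = none ∧ boxCf n i lo = some hi ∧ boxCe n i hi = some lo ∧ boxCf n i hi = none

theorem word_E (n i : ℕ) (A M B : List ℕ) (lo hi lo' hi' : ℕ) (hA : ∀ x ∈ A, Irr n i x)
    (hM : ∀ x ∈ M, Irr n i x) (hB : ∀ x ∈ B, Irr n i x) (h : LoHi n i lo hi)
    (h' : LoHi n i lo' hi') (s : B4) :
    listE (boxC n) i (word A M B lo hi lo' hi' s) = (sE s).map (word A M B lo hi lo' hi') := by
  obtain ⟨a1, a2, a3, a4⟩ := h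
  obtain ⟨b1, b2, b3, b4⟩ := h'
  have hB0 : listEps (boxC n) i B = 0 := by
    have := irrs_eps n i B [] hB
    simpa [listEps] using this
  have hB1 := listE_none n i B hB0
  obtain ⟨p, q, p', q'⟩ := s
  have e1 : ∀ v, (boxC n).eps v i = if (boxCe n i v).isSome then 1 else 0 := fun v => rfl
  have e2 : ∀ v, (boxC n).phi v i = if (boxCf n i v).isSome then 1 else 0 := fun v => rfl
  have e3 : ∀ v, (boxC n).e i v = boxCe n i v := fun v => rfl
  simp only [word]
  rw [irrs_E _ _ _ _ hA]
  cases p <;> cases q <;> cases p' <;> cases q' <;>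
    simp [bl, sE, listE, listEps, irrs_E _ _ _ _ hM, irrs_eps _ _ _ _ hM, e1, e2, e3,
      a1, a2, a3, a4, b1, b2, b3, b4, hB0, hB1, word]

theorem word_F (n i : ℕ) (A M B : List ℕ) (lo hi lo' hi' : ℕ) (hA : ∀ x ∈ A, Irr n i x)
    (hM : ∀ x ∈ M, Irr n i x) (hB : ∀ x ∈ B, Irr n i x) (h : LoHi n i lo hi)
    (h' : LoHi n i lo' hi') (s : B4) :
    listF (boxC n) i (word A M B lo hi lo' hi' s) = (sF s).map (word A M B lo hi lo' hi') := by
  obtain ⟨a1, a2, a3, a4⟩ := h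
  obtain ⟨b1, b2, b3, b4⟩ := h'
  have hB0 : listEps (boxC n) i B = 0 := by
    have := irrs_eps n i B [] hB
    simpa [listEps] using this
  have hB1 : listF (boxC n) i B = none := by
    have := irrs_F n i B [] hB
    simpa [listF] using this
  obtain ⟨p, q, p', q'⟩ := s
  have e1 : ∀ v, (boxC n).eps v i = if (boxCe n i v).isSome then 1 else 0 := fun v => rfl
  have e2 : ∀ v, (boxC n).phi v i = if (boxCf n i v).isSome then 1 else 0 := fun v => rfl
  have e3 : ∀ v, (boxC n).f i v = boxCf n i v := fun v => rfl
  simp only [word]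
  rw [irrs_F _ _ _ _ hA]
  cases p <;> cases q <;> cases p' <;> cases q' <;>
    simp [bl, sF, listF, listEps, irrs_F _ _ _ _ hM, irrs_eps _ _ _ _ hM, e1, e2, e3,
      a1, a2, a3, a4, b1, b2, b3, b4, hB0, hB1, word]

end KN
namespace KN

theorem range_split4 (n i : ℕ) (hi : 1 ≤ i) (hin : i < n) :
    List.range (2 * n) = List.range (i - 1) ++ ([i - 1, i] ++ (List.range' (i + 1) (2 * n - 2 * i - 2)
      ++ ([2 * n - i - 1, 2 * n - i - 1 + 1] ++ List.range' (2 * n - i - 1 + 2) (i - 1)))) := by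
  obtain ⟨j, rfl⟩ : ∃ j, i = j + 1 := ⟨i - 1, by omega⟩
  obtain ⟨m, rfl⟩ : ∃ m, n = j + 2 + m := ⟨n - j - 2, by omega⟩
  rw [range_split _ j (by omega)]
  congr 1
  have e1 : 2 * (j + 2 + m) - j - 1 = (1 + (2 * m + (2 + j))) := by omega
  have e2 : 2 * (j + 2 + m) - (j + 1) - 1 = j + 2 + 2 * m := by omega
  have e3 : 2 * (j + 2 + m) - 2 * (j + 1) - 2 = 2 * m := by omega
  rw [e1, e2, e3, ← List.range'_append_1, ← List.range'_append_1, ← List.range'_append_1]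
  simp [List.range'_succ]

theorem range_split2 (n P : ℕ) (h : P + 1 < 2 * n) :
    List.range (2 * n) = List.range P ++ ([P, P + 1] ++ List.range' (P + 2) (2 * n - P - 2)) := by
  rw [range_split _ P (by omega)]
  congr 1
  obtain ⟨m, hm⟩ : ∃ m, 2 * n - P - 1 = m + 1 := ⟨2 * n - P - 2, by omega⟩
  have : 2 * n - P - 2 = m := by omega
  rw [hm, this, List.range'_succ]
  rfl

def set2 (f : ℕ → Bool) (P : ℕ) (a b : Bool) (x : ℕ) : Bool :=
  if x = P then a else if x = P + 1 then b else f x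

theorem set2_self (f : ℕ → Bool) (P : ℕ) : set2 f P (f P) (f (P + 1)) = f := by
  funext x
  simp only [set2]
  split_ifs with h h <;> simp_all

theorem set2_of_ne (f : ℕ → Bool) (P : ℕ) (a b : Bool) (x : ℕ) (h : x ≠ P) (h' : x ≠ P + 1) :
    set2 f P a b x = f x := by simp [set2, h, h']

theorem filter_pair (f : ℕ → Bool) (x y : ℕ) : [x, y].filter f = bl x y (f x) (f y) := by
  cases h : f x <;> cases h' : f y <;> simp [bl, h, h']

/-- The column word of `toT` after modification at positions `P, P+1`. -/
theorem col_toT_word (n i P : ℕ) (hi : 1 ≤ i) (hin : i < n) (hP : P = 2 * n - i - 1)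
    (u v : ℕ → Bool) (p q p' q' : Bool) :
    col n (toT n (set2 u P p' q') (set2 v P p q)) =
      word ((List.range (i - 1)).filter (toT n u v))
        ((List.range' (i + 1) (2 * n - 2 * i - 2)).filter (toT n u v))
        ((List.range' (P + 2) (i - 1)).filter (toT n u v)) (i - 1) i P (P + 1)
        (!q, !p, p', q') := by
  have hne : ∀ x, x < 2 * n → x ≠ i - 1 → x ≠ i → x ≠ P → x ≠ P + 1 →
      toT n (set2 u P p' q') (set2 v P p q) x = toT n u v x := by
    intro x h0 h1 h2 h3 h4
    simp only [toT]
    split_ifs with h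
    · rw [set2_of_ne]
      · omega
      · omega
    · rw [set2_of_ne _ _ _ _ _ h3 h4]
  have b1 : toT n (set2 u P p' q') (set2 v P p q) (i - 1) = !q := by
    simp only [toT, if_pos (show i - 1 < n by omega), set2]
    rw [if_neg (by omega), if_pos (by omega)]
  have b2 : toT n (set2 u P p' q') (set2 v P p q) i = !p := by
    simp only [toT, if_pos (show i < n by omega), set2]
    rw [if_pos (by omega)]
  have b3 : toT n (set2 u P p' q') (set2 v P p q) P = p' := by
    simp only [toT, if_neg (show ¬ P < n by omega), set2, if_true]
  have b4 : toT n (set2 u P p' q') (set2 v P p q) (P + 1) = q' := by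
    simp only [toT, if_neg (show ¬ P + 1 < n by omega), set2]
    simp
  unfold col
  rw [range_split4 n i hi hin, ← hP]
  simp only [List.filter_append, filter_pair, b1, b2, b3, b4, word]
  congr 1
  · apply List.filter_congr
    intro x hx
    have := List.mem_range.1 hx
    apply hne <;> omega
  · congr 1
    congr 1
    · apply List.filter_congr
      intro x hx
      have := List.mem_range'_1.1 hx
      apply hne <;> omega
    · congr 1
      apply List.filter_congr
      intro x hx
      have := List.mem_range'_1.1 hx
      apply hne <;> omega

theorem col_set2 (n P : ℕ) (h : P + 1 < 2 * n) (f : ℕ → Bool) (a b : Bool) :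
    col n (set2 f P a b) = (List.range P).filter f ++ (bl P (P + 1) a b ++
      (List.range' (P + 2) (2 * n - P - 2)).filter f) := by
  unfold col
  rw [range_split2 n P h]
  have b1 : set2 f P a b P = a := by simp [set2]
  have b2 : set2 f P a b (P + 1) = b := by simp [set2]
  simp only [List.filter_append, filter_pair, b1, b2]
  congr 1
  · apply List.filter_congr
    intro x hx
    have := List.mem_range.1 hx
    apply set2_of_ne <;> omega
  · congr 1
    apply List.filter_congr
    intro x hx
    have := List.mem_range'_1.1 hx
    apply set2_of_ne <;> omega

theorem pair_word (n P : ℕ) (h : P + 1 < 2 * n) (u v : ℕ → Bool) (p q p' q' : Bool) :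
    col n (set2 v P p q) ++ col n (set2 u P p' q') =
      word ((List.range P).filter v)
        ((List.range' (P + 2) (2 * n - P - 2)).filter v ++ (List.range P).filter u)
        ((List.range' (P + 2) (2 * n - P - 2)).filter u) P (P + 1) P (P + 1) (p, q, p', q') := by
  rw [col_set2 n P h, col_set2 n P h]
  simp [word, List.append_assoc]

theorem length_set2 (n P : ℕ) (h : P + 1 < 2 * n) (f : ℕ → Bool) (a b : Bool) :
    (col n (set2 f P a b)).length = ((List.range P).filter f).length +
      (List.filter f (List.range' (P + 2) (2 * n - P - 2))).length + (a.toNat + b.toNat) := by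
  rw [col_set2 n P h]
  cases a <;> cases b <;> simp [bl] <;> omega

def gstep (g : ℕ) (a b : Bool) : ℕ := if a = b then g else if a then g + 1 else g - 1
def rstep (g : ℕ) (a b : Bool) : Bool := b && !a && decide (g = 0)

/-- Local form of the transformation at two adjacent positions. -/
def ob (g : ℕ) : B4 → B4
  | (p, q, p', q') => (p && !rstep g p' p, q && !rstep (gstep g p' p) q' q,
      p' || rstep g p' p, q' || rstep (gstep g p' p) q' q)

def og (g : ℕ) : B4 → ℕ
  | (p, q, p', q') => gstep (gstep g p' p) q' q

def bits (P : ℕ) (u v : ℕ → Bool) : B4 := (v P, v (P + 1), u P, u (P + 1))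

theorem bits_out (P : ℕ) (u v : ℕ → Bool) :
    bits P (outU u v) (outV u v) = ob (gap u v P) (bits P u v) := rfl

theorem gap_og (P : ℕ) (u v : ℕ → Bool) : gap u v (P + 2) = og (gap u v P) (bits P u v) := rfl

theorem loc_E (g : ℕ) (s : B4) : sE (ob g s) = (sE s).map (ob g) ∧
    ∀ s2, sE s = some s2 → og g s2 = og g s := by
  obtain ⟨p, q, p', q'⟩ := s
  rcases g with _ | _ | g <;> cases p <;> cases q <;> cases p' <;> cases q' <;>
    simp [sE, ob, og, gstep, rstep]

theorem loc_F (g : ℕ) (s : B4) : sF (ob g s) = (sF s).map (ob g) ∧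
    ∀ s2, sF s = some s2 → og g s2 = og g s := by
  obtain ⟨p, q, p', q'⟩ := s
  rcases g with _ | _ | g <;> cases p <;> cases q <;> cases p' <;> cases q' <;>
    simp [sF, ob, og, gstep, rstep]

def dual : B4 → B4
  | (p, q, p', q') => (!q, !p, p', q')

theorem dual_E (s : B4) : sE (dual s) = (sE s).map dual := by
  revert s; decide

theorem dual_F (s : B4) : sF (dual s) = (sF s).map dual := by
  revert s; decide

theorem len_E : ∀ s s2 : B4, sE s = some s2 →
    s2.1.toNat + s2.2.1.toNat = s.1.toNat + s.2.1.toNat := by decide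

theorem len_F : ∀ s s2 : B4, sF s = some s2 →
    s2.1.toNat + s2.2.1.toNat = s.1.toNat + s.2.1.toNat := by decide

theorem gap_after {u v u2 v2 : ℕ → Bool} (P : ℕ) (h0 : gap u2 v2 P = gap u v P)
    (h : ∀ x, P ≤ x → u2 x = u x ∧ v2 x = v x) : ∀ x, P ≤ x → gap u2 v2 x = gap u v x := by
  intro x hx
  induction x, hx using Nat.le_induction with
  | base => exact h0
  | succ x hx ih => simp only [gap, ih, (h x hx).1, (h x hx).2]

theorem Supp.set2 {n : ℕ} {f : ℕ → Bool} (h : Supp n f) (P : ℕ) (a b : Bool) (h1 : n ≤ P)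
    (h2 : P + 1 < 2 * n) : Supp n (set2 f P a b) := by
  intro x hx
  simp only [KN.set2] at hx
  split_ifs at hx with h3 h3
  · omega
  · omega
  · exact h x hx

theorem cryst_lt (n i : ℕ) (hi : 1 ≤ i) (hin : i < n) (lop : List ℕ → Option (List ℕ))
    (s : B4 → Option B4)
    (hw : ∀ (A M B : List ℕ) (lo hi lo' hi' : ℕ), (∀ x ∈ A, Irr n i x) → (∀ x ∈ M, Irr n i x) →
      (∀ x ∈ B, Irr n i x) → LoHi n i lo hi → LoHi n i lo' hi' → ∀ b,
      lop (word A M B lo hi lo' hi' b) = (s b).map (word A M B lo hi lo' hi'))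
    (hloc : ∀ g b, s (ob g b) = (s b).map (ob g) ∧ ∀ b2, s b = some b2 → og g b2 = og g b)
    (hdual : ∀ b, s (dual b) = (s b).map dual)
    (hlen : ∀ b b2, s b = some b2 → b2.1.toNat + b2.2.1.toNat = b.1.toNat + b.2.1.toNat)
    (u v : ℕ → Bool) (hu : Supp n u) (hv : Supp n v) (hg : gap u v (2 * n) = 0) :
    (lop (col n (toT n u v))).map (PsiCol n) =
      (lop (col n (outV u v) ++ col n (outU u v))).map
        (fun w => (w.drop (col n (outV u v)).length, w.take (col n (outV u v)).length)) := by
  obtain ⟨P, hP⟩ : ∃ P, P = 2 * n - i - 1 := ⟨_, rfl⟩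
  have hPn : n ≤ P := by omega
  have hP2 : P + 1 < 2 * n := by omega
  have l1 : LoHi n i (i - 1) i := by
    refine ⟨?_, ?_, ?_, ?_⟩
    · simp only [boxCe, if_pos (And.intro hi hin)]
      rw [if_neg (by omega), if_neg (by omega)]
    · simp only [boxCf, if_pos (And.intro hi hin)]
      rw [if_pos (by omega)]
    · simp only [boxCe, if_pos (And.intro hi hin), if_true]
    · simp only [boxCf, if_pos (And.intro hi hin)]
      rw [if_neg (by omega), if_neg (by omega)]
  have l2 : LoHi n i P (P + 1) := by
    refine ⟨?_, ?_, ?_, ?_⟩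
    · simp only [boxCe, if_pos (And.intro hi hin)]
      rw [if_neg (by omega), if_neg (by omega)]
    · simp only [boxCf, if_pos (And.intro hi hin)]
      rw [if_neg (by omega), if_pos (by omega)]
    · simp only [boxCe, if_pos (And.intro hi hin)]
      rw [if_neg (by omega), if_pos (by omega)]
      rfl
    · simp only [boxCf, if_pos (And.intro hi hin)]
      rw [if_neg (by omega), if_neg (by omega)]
  have irr : ∀ x, x ≠ i - 1 → x ≠ i → x ≠ P → x ≠ P + 1 → Irr n i x := by
    intro x h1 h2 h3 h4
    constructor
    · simp only [boxCe, if_pos (And.intro hi hin)]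
      rw [if_neg (by omega), if_neg (by omega)]
    · simp only [boxCf, if_pos (And.intro hi hin)]
      rw [if_neg (by omega), if_neg (by omega)]
  have irr_sub : ∀ (f : ℕ → Bool) (l : List ℕ), (∀ x ∈ l, x ≠ i - 1 ∧ x ≠ i ∧ x ≠ P ∧ x ≠ P + 1) →
      ∀ x ∈ l.filter f, Irr n i x := by
    intro f l h x hx
    obtain ⟨h1, h2, h3, h4⟩ := h x (List.mem_filter.1 hx).1
    exact irr x h1 h2 h3 h4
  -- left-hand side
  have hL : lop (col n (toT n u v)) = (s (bits P u v)).map (fun b =>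
      col n (toT n (set2 u P b.2.2.1 b.2.2.2) (set2 v P b.1 b.2.1))) := by
    have h0 := col_toT_word n i P hi hin hP u v (v P) (v (P + 1)) (u P) (u (P + 1))
    rw [set2_self, set2_self] at h0
    rw [h0]
    rw [hw _ _ _ _ _ _ _ (irr_sub _ _ ?_) (irr_sub _ _ ?_) (irr_sub _ _ ?_) l1 l2]
    · have := hdual (bits P u v)
      simp only [bits, dual] at this ⊢
      rw [this, Option.map_map]
      congr 1
      funext b
      obtain ⟨p, q, p', q'⟩ := b
      rw [col_toT_word n i P hi hin hP]
      rfl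
    · intro x hx
      have := List.mem_range.1 hx
      omega
    · intro x hx
      have := List.mem_range'_1.1 hx
      omega
    · intro x hx
      have := List.mem_range'_1.1 hx
      omega
  -- right-hand side
  have hR : ∀ p q : ℕ → Bool, Supp n p → Supp n q → (lop (col n q ++ col n p)).map
      (fun w => (w.drop (col n q).length, w.take (col n q).length)) =
      (s (bits P p q)).map (fun b =>
        (col n (set2 p P b.2.2.1 b.2.2.2), col n (set2 q P b.1 b.2.1))) := by
    intro p q hp hq
    have irr_lo : ∀ f : ℕ → Bool, Supp n f → ∀ x ∈ (List.range P).filter f, Irr n i x := by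
      intro f hf x hx
      rw [List.mem_filter, List.mem_range] at hx
      have := hf x hx.2
      apply irr <;> omega
    have irr_hi : ∀ f : ℕ → Bool, Supp n f →
        ∀ x ∈ (List.range' (P + 2) (2 * n - P - 2)).filter f, Irr n i x := by
      intro f hf x hx
      rw [List.mem_filter, List.mem_range'_1] at hx
      apply irr <;> omega
    have h0 := pair_word n P hP2 p q (q P) (q (P + 1)) (p P) (p (P + 1))
    rw [set2_self, set2_self] at h0
    rw [h0, hw _ _ _ _ _ _ _ (irr_lo q hq) ?_ (irr_hi p hp) l2 l2]
    · simp only [bits]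
      rw [Option.map_map]
      cases hs : s (q P, q (P + 1), p P, p (P + 1)) with
      | none => rfl
      | some b =>
        have hl := hlen _ _ hs
        obtain ⟨c1, c2, c3, c4⟩ := b
        simp only [Option.map_some, Function.comp]
        rw [← pair_word n P hP2]
        have e1 := length_set2 n P hP2 q c1 c2
        have e2 := length_set2 n P hP2 q (q P) (q (P + 1))
        rw [set2_self] at e2
        have e3 : (col n q).length = (col n (set2 q P c1 c2)).length := by
          simp only at hl
          omega
        rw [e3, List.drop_left, List.take_left]
    · intro x hx
      rw [List.mem_append] at hx
      rcases hx with hx | hx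
      · exact irr_hi q hq x hx
      · exact irr_lo p hp x hx
  rw [hL, hR _ _ (hu.outU hv) hv.outV, bits_out, (hloc _ _).1, Option.map_map, Option.map_map]
  cases hs : s (bits P u v) with
  | none => rfl
  | some b =>
    have hog := (hloc (gap u v P) _).2 b hs
    obtain ⟨p, q, p', q'⟩ := b
    simp only [Option.map_some, Function.comp]
    congr 1
    have g1 : ∀ x ≤ P, gap (set2 u P p' q') (set2 v P p q) x = gap u v x := by
      apply gap_congr
      intro x hx
      rw [set2_of_ne _ _ _ _ _ (by omega) (by omega), set2_of_ne _ _ _ _ _ (by omega) (by omega)]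
      exact ⟨rfl, rfl⟩
    have hb : bits P (set2 u P p' q') (set2 v P p q) = (p, q, p', q') := by
      simp [bits, set2]
    have g2 : gap (set2 u P p' q') (set2 v P p q) (P + 2) = gap u v (P + 2) := by
      rw [gap_og, gap_og, hb, g1 P le_rfl, hog]
    have g3 : ∀ x, P + 2 ≤ x → gap (set2 u P p' q') (set2 v P p q) x = gap u v x := by
      apply gap_after _ g2
      intro x hx
      rw [set2_of_ne _ _ _ _ _ (by omega) (by omega), set2_of_ne _ _ _ _ _ (by omega) (by omega)]
      exact ⟨rfl, rfl⟩
    rw [PsiCol_toT n _ _ (hu.set2 P _ _ hPn hP2) (hv.set2 P _ _ hPn hP2)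
      (by rw [g3 _ (by omega), hg])]
    have ho := bits_out P (set2 u P p' q') (set2 v P p q)
    rw [hb, g1 P le_rfl] at ho
    rw [← ho]
    simp only [bits]
    congr 1
    · apply col_congr
      intro x hx
      by_cases h1 : x = P
      · subst h1; simp only [set2, if_true]
      · by_cases h2 : x = P + 1
        · subst h2; simp [KN.set2]
        · rw [set2_of_ne _ _ _ _ _ h1 h2]
          have : gap (set2 u P p' q') (set2 v P p q) x = gap u v x := by
            rcases Nat.lt_or_ge P x with h | h
            · exact g3 x (by omega)
            · exact g1 x h
          simp only [outU, rec1, this, set2_of_ne _ _ _ _ _ h1 h2]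
    · apply col_congr
      intro x hx
      by_cases h1 : x = P
      · subst h1; simp only [set2, if_true]
      · by_cases h2 : x = P + 1
        · subst h2; simp [KN.set2]
        · rw [set2_of_ne _ _ _ _ _ h1 h2]
          have : gap (set2 u P p' q') (set2 v P p q) x = gap u v x := by
            rcases Nat.lt_or_ge P x with h | h
            · exact g3 x (by omega)
            · exact g1 x h
          simp only [outV, rec1, this, set2_of_ne _ _ _ _ _ h1 h2]

end KN
namespace KN

theorem range_split_mid (n : ℕ) (hn : 2 ≤ n) :
    List.range (2 * n) = List.range (n - 1) ++ ([n - 1, n] ++ List.range' (n + 1) (n - 1)) := by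
  have h := range_split2 n (n - 1) (by omega)
  rw [h, show n - 1 + 1 = n by omega, show n - 1 + 2 = n + 1 by omega,
    show 2 * n - (n - 1) - 2 = n - 1 by omega]

/-- The part of a column strictly below `n`. -/
def rest (n : ℕ) (f : ℕ → Bool) : List ℕ := (List.range' (n + 1) (n - 1)).filter f

theorem rest_gt (n : ℕ) (f : ℕ → Bool) : ∀ x ∈ rest n f, n < x := by
  intro x hx
  have := List.mem_range'_1.1 (List.mem_filter.1 hx).1
  omega

theorem col_rest (n : ℕ) (hn : 2 ≤ n) (f : ℕ → Bool) (hf : Supp n f) (a : Bool) :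
    col n (Function.update f n a) = (if a then [n] else []) ++ rest n f := by
  have hs : ∀ x, x < n → f x = false := by
    intro x hx
    by_contra hc
    have := hf x (by simpa using hc)
    omega
  unfold col rest
  rw [range_split_mid n hn, List.filter_append, List.filter_append, filter_update_hi, filter_pair,
    Function.update_self, Function.update_of_ne (show n - 1 ≠ n by omega), hs (n - 1) (by omega)]
  have : (List.range (n - 1)).filter (Function.update f n a) = [] := by
    rw [List.filter_eq_nil_iff]
    intro x hx
    have := List.mem_range.1 hx
    rw [Function.update_of_ne (by omega), hs x (by omega)]
    simp
  rw [this]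
  simp [bl]

theorem col_toT_mid (n : ℕ) (hn : 2 ≤ n) (u v : ℕ → Bool) (a b : Bool) :
    col n (toT n (Function.update u n a) (Function.update v n b)) =
      word ((List.range (n - 1)).filter (toT n u v)) [] (rest n u) (n - 1) n (n - 1) n
        (!b, a, false, false) := by
  unfold col rest
  rw [range_split_mid n hn, List.filter_append, List.filter_append, filter_pair]
  have b1 : toT n (Function.update u n a) (Function.update v n b) (n - 1) = !b := by
    simp only [toT, if_pos (show n - 1 < n by omega)]
    rw [show 2 * n - 1 - (n - 1) = n by omega, Function.update_self]
  have b2 : toT n (Function.update u n a) (Function.update v n b) n = a := by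
    simp [toT]
  rw [b1, b2]
  simp only [word, bl, Bool.false_eq_true, if_false, List.nil_append]
  congr 1
  · apply List.filter_congr
    intro x hx
    have := List.mem_range.1 hx
    simp only [toT, if_pos (show x < n by omega)]
    rw [Function.update_of_ne (by omega)]
  · congr 1
    apply List.filter_congr
    intro x hx
    have := List.mem_range'_1.1 hx
    simp only [toT, if_neg (show ¬ x < n by omega)]
    rw [Function.update_of_ne (by omega)]

theorem gap_supp {n : ℕ} {u v : ℕ → Bool} (hu : Supp n u) (hv : Supp n v) : gap u v n = 0 := by
  have h := inv1 u v n
  have h1 := hu.cnt n le_rfl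
  have h2 := hv.cnt n le_rfl
  have h3 := (hu.outU hv).cnt n le_rfl
  have h4 := inv3 u v n
  omega

theorem Supp.update {n : ℕ} {f : ℕ → Bool} (h : Supp n f) (hn : 2 ≤ n) (a : Bool) :
    Supp n (Function.update f n a) := by
  intro x hx
  by_cases hxn : x = n
  · omega
  · rw [Function.update_of_ne hxn] at hx
    exact h x hx

/-- Changing both bits at `n` simultaneously between `00` and `11`. -/
theorem out_update (n : ℕ) (u v : ℕ → Bool) (a : Bool) (h : u n = v n) :
    (∀ x, gap (Function.update u n a) (Function.update v n a) x = gap u v x) ∧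
    outU (Function.update u n a) (Function.update v n a) = Function.update (outU u v) n a ∧
    outV (Function.update u n a) (Function.update v n a) = Function.update (outV u v) n a := by
  have hg : ∀ x, gap (Function.update u n a) (Function.update v n a) x = gap u v x := by
    intro x
    induction x with
    | zero => rfl
    | succ x ih =>
      by_cases hx : x = n
      · subst hx; simp [gap, ih, h]
      · simp only [gap, ih, Function.update_of_ne hx]
  refine ⟨hg, ?_, ?_⟩
  · funext x
    by_cases hx : x = n
    · subst hx; cases a <;> simp [outU, rec1]
    · simp only [outU, rec1, hg, Function.update_of_ne hx]
  · funext x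
    by_cases hx : x = n
    · subst hx; cases a <;> simp [outV, rec1]
    · simp only [outV, rec1, hg, Function.update_of_ne hx]

theorem head_rest (n : ℕ) (f : ℕ → Bool) : (rest n f).head? ≠ some n := by
  intro h
  have := rest_gt n f n (List.mem_of_head? h)
  omega

theorem dom_iff (n : ℕ) (p q : ℕ → Bool) (a b : Bool)
    (hlen : ((if b then [n] else []) ++ rest n q).length
      ≤ ((if a then [n] else []) ++ rest n p).length) :
    dominoTop n ((if a then [n] else []) ++ rest n p, (if b then [n] else []) ++ rest n q)
      = (a && b) := by
  simp only [dominoTop, decide_eq_true hlen, Bool.and_true]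
  have h1 := head_rest n p
  have h2 := head_rest n q
  cases a <;> cases b <;> simp [h1, h2]

theorem can_iff (n : ℕ) (p q : ℕ → Bool) (a b : Bool)
    (hlen : ((if b then [n] else []) ++ rest n q).length
      ≤ ((if a then [n] else []) ++ rest n p).length) :
    canDomino n ((if a then [n] else []) ++ rest n p, (if b then [n] else []) ++ rest n q)
      = (!a && !b) := by
  simp only [canDomino, decide_eq_true hlen, Bool.and_true]
  have key : ∀ f, (match (rest n f).head? with | some x => decide (n < x) | none => true) = true := by
    intro f
    cases h : (rest n f).head? with
    | none => rfl
    | some x => simpa using rest_gt n f x (List.mem_of_head? h)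
  have h1 := key p
  have h2 := key q
  cases a <;> cases b <;> simp [h1, h2]

theorem loHi_n (n : ℕ) (hn : 2 ≤ n) : LoHi n n (n - 1) n := by
  refine ⟨?_, ?_, ?_, ?_⟩
  · simp [boxCe]; omega
  · simp [boxCf]; omega
  · simp [boxCe]
  · simp [boxCf]

theorem irr_n (n x : ℕ) (h1 : x ≠ n - 1) (h2 : x ≠ n) : Irr n n x := by
  constructor
  · simp [boxCe, h2]
  · simp [boxCf]; omega

theorem cryst_n (n : ℕ) (hn : 2 ≤ n) (u v : ℕ → Bool) (hu : Supp n u) (hv : Supp n v)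
    (hg : gap u v (2 * n) = 0) :
    (listE (boxC n) n (col n (toT n u v))).map (PsiCol n) =
      (pairPC n).e n (col n (outU u v), col n (outV u v)) ∧
    (listF (boxC n) n (col n (toT n u v))).map (PsiCol n) =
      (pairPC n).f n (col n (outU u v), col n (outV u v)) := by
  have hlen : (col n (outV u v)).length ≤ (col n (outU u v)).length := by
    rw [length_col, length_col]
    have := inv1 u v (2 * n)
    have := inv2 u v (2 * n)
    have := inv3 u v (2 * n)
    omega
  have hgn := gap_supp hu hv
  have hw := col_toT_mid n hn u v (u n) (v n)
  rw [Function.update_eq_self, Function.update_eq_self] at hw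
  have i1 : ∀ x ∈ (List.range (n - 1)).filter (toT n u v), Irr n n x := by
    intro x hx
    have := List.mem_range.1 (List.mem_filter.1 hx).1
    exact irr_n n x (by omega) (by omega)
  have i3 : ∀ x ∈ rest n u, Irr n n x := by
    intro x hx
    have := rest_gt n u x hx
    exact irr_n n x (by omega) (by omega)
  have hE := word_E n n _ [] _ _ _ _ _ i1 (by simp) i3 (loHi_n n hn) (loHi_n n hn)
    (!v n, u n, false, false)
  have hF := word_F n n _ [] _ _ _ _ _ i1 (by simp) i3 (loHi_n n hn) (loHi_n n hn)
    (!v n, u n, false, false)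
  rw [← hw] at hE hF
  have hoU := hu.outU hv
  have hoV : Supp n (outV u v) := hv.outV
  have hcU := col_rest n hn _ hoU (outU u v n)
  have hcV := col_rest n hn _ hoV (outV u v n)
  rw [Function.update_eq_self] at hcU hcV
  rw [hcU, hcV] at hlen
  have hd := dom_iff n _ _ _ _ hlen
  have hc := can_iff n _ _ _ _ hlen
  have bU : outU u v n = (u n || v n) := by
    simp only [outU, rec1, hgn]; cases u n <;> cases v n <;> rfl
  have bV : outV u v n = (u n && v n) := by
    simp only [outV, rec1, hgn]; cases u n <;> cases v n <;> rfl
  have hpsi : ∀ a, u n = v n → PsiCol n (col n (toT n (Function.update u n a) (Function.update v n a)))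
      = ((if a then [n] else []) ++ rest n (outU u v), (if a then [n] else []) ++ rest n (outV u v)) := by
    intro a h
    obtain ⟨o1, o2, o3⟩ := out_update n u v a h
    rw [PsiCol_toT n _ _ (hu.update hn a) (hv.update hn a) (by rw [o1, hg]), o2, o3,
      col_rest n hn _ hoU, col_rest n hn _ hoV]
  have hwa := fun a => col_toT_mid n hn u v a a
  rw [hE, hF]
  simp only [pairPC, if_true]
  rw [hcU, hcV, hd, hc, bU, bV]
  have w0 := hwa false
  have w1 := hwa true
  cases h1 : u n <;> cases h2 : v n
  · have := hpsi true (by rw [h1, h2])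
    rw [w1] at this
    simp [sE, sF] at this ⊢
    exact this
  · simp [sE, sF]
  · simp [sE, sF]
  · have := hpsi false (by rw [h1, h2])
    rw [w0] at this
    simp [sE, sF] at this ⊢
    exact this

end KN
open KN

theorem PsiCol_crystal_iso (n a : ℕ) (hn : 2 ≤ n) (ha : a < n) :
    (∀ T ∈ KNcolC n a, PsiCol n T ∈ TCnSet n (n - a)) ∧
    Set.BijOn (PsiCol n) (KNcolC n a) (TCnSet n (n - a)) ∧
    (∀ T ∈ KNcolC n a, ∀ k, 1 ≤ k → k ≤ n →
        1 + wtList n ((PsiCol n T).1 ++ (PsiCol n T).2) k = wtList n T k) ∧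
    (∀ i, 1 ≤ i → i ≤ n → ∀ T ∈ KNcolC n a,
        (listE (boxC n) i T).map (PsiCol n) = (pairPC n).e i (PsiCol n T) ∧
        (listF (boxC n) i T).map (PsiCol n) = (pairPC n).f i (PsiCol n T)) := by
  refine ⟨(psi_bij n a ha).mapsTo, psi_bij n a ha, ?_, ?_⟩
  · intro T hT k hk hkn
    obtain ⟨u, v, hu, hv, rfl⟩ := exists_toT n T hT.2.1 hT.2.2.1
    rw [PsiCol_toT n u v hu hv ((mem_KN_toT n a u v hu hv).1 hT).2]
    exact wt_main n k hk hkn u v hu hv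
  · intro i hi hin T hT
    obtain ⟨u, v, hu, hv, rfl⟩ := exists_toT n T hT.2.1 hT.2.2.1
    have hg := ((mem_KN_toT n a u v hu hv).1 hT).2
    rw [PsiCol_toT n u v hu hv hg]
    rcases Nat.lt_or_ge i n with h | h
    · simp only [pairPC, if_neg (Nat.ne_of_lt h)]
      exact ⟨cryst_lt n i hi h (listE (boxC n) i) sE
          (fun A M B lo hi lo' hi' hA hM hB h1 h2 b => word_E n i A M B lo hi lo' hi' hA hM hB h1 h2 b)
          loc_E dual_E len_E u v hu hv hg,
        cryst_lt n i hi h (listF (boxC n) i) sF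
          (fun A M B lo hi lo' hi' hA hM hB h1 h2 b => word_F n i A M B lo hi lo' hi' hA hM hB h1 h2 b)
          loc_F dual_F len_F u v hu hv hg⟩
    · have : i = n := by omega
      subst this
      exact cryst_n i hn u v hu hv hg
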